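/- There exists ε₀ > 0 such that for every ε ∈ (0, ε₀) and every δ > 0 there exists R > 0 with the following property: every z ∈ ℂ with Re z ≥ R, 0 ≤ Im z ≤ Re z and m(z) = ε (i.e. z lies on the part of the level line ‖(Q − z)^{−1}‖ = 1/ε below the diagonal e^{iπ/4}ℝ) satisfies |Im z − (3/2)^{2/3}·(Re z)^{1/3}·(ln((Re z)^{1/3}/ε))^{2/3}| ≤ δ·(Re z)^{1/3}·(ln Re z)^{2/3}. In particular, along the level line, Im z = (1 + o(1))·(3/2)^{2/3}·(Re z)^{1/3}·(ln((Re z)^{1/3}/ε))^{2/3} as Re z → ∞. -/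

import Mathlib

open Complex MeasureTheory

/-- `mQ z` is the infimum of `‖Qu − zu‖_{L²}/‖u‖_{L²}` over nonzero Schwartz functions,
where `Q = Dₓ² + ix²` is the non-self-adjoint harmonic oscillator;
`1/mQ z = ‖(Q − z)^{-1}‖`. -/
noncomputable def mQ (z : ℂ) : ℝ :=
  sInf {r : ℝ | ∃ u : SchwartzMap ℝ ℂ, u ≠ 0 ∧
    r = (eLpNorm (fun x : ℝ =>
          -(deriv (deriv ⇑u) x) + Complex.I * (x:ℂ) ^ 2 * u x - z * u x) 2 volume).toReal
        / (eLpNorm (⇑u) 2 volume).toReal}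


/-! ### The complex square root `λ(x) = sqrt (a + i (b - x²))` -/

noncomputable def hh (a b x : ℝ) : ℂ := (a : ℂ) + ((b - x ^ 2 : ℝ) : ℂ) * I

noncomputable def lam (a b x : ℝ) : ℂ := Complex.exp (Complex.log (hh a b x) / 2)

lemma hh_re (a b x : ℝ) : (hh a b x).re = a := by simp [hh, -ofReal_sub, -ofReal_pow]
lemma hh_im (a b x : ℝ) : (hh a b x).im = b - x ^ 2 := by simp [hh, -ofReal_sub, -ofReal_pow]

lemma hh_slit {a : ℝ} (ha : 0 < a) (b x : ℝ) : hh a b x ∈ slitPlane := by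
  left; rw [hh_re]; exact ha

lemma hh_ne {a : ℝ} (ha : 0 < a) (b x : ℝ) : hh a b x ≠ 0 := slitPlane_ne_zero (hh_slit ha b x)

lemma lam_ne (a b x : ℝ) : lam a b x ≠ 0 := Complex.exp_ne_zero _

lemma lam_sq {a : ℝ} (ha : 0 < a) (b x : ℝ) : lam a b x ^ 2 = hh a b x := by
  unfold lam
  rw [← Complex.exp_nat_mul]
  have : ((2:ℕ):ℂ) * (Complex.log (hh a b x) / 2) = Complex.log (hh a b x) := by push_cast; ring
  rw [this, Complex.exp_log (hh_ne ha b x)]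

lemma lam_re_pos {a : ℝ} (ha : 0 < a) (b x : ℝ) : 0 < (lam a b x).re := by
  unfold lam
  rw [Complex.exp_re]
  apply mul_pos (Real.exp_pos _)
  apply Real.cos_pos_of_mem_Ioo
  have h1 := Complex.neg_pi_lt_log_im (hh a b x)
  have h2 := Complex.log_im_le_pi (hh a b x)
  have : (Complex.log (hh a b x) / 2).im = (Complex.log (hh a b x)).im / 2 := by simp
  rw [this]
  rcases h2.lt_or_eq with h | h
  · constructor <;> linarith
  · exfalso
    rw [Complex.log_im] at h
    exact (Complex.mem_slitPlane_iff_arg.1 (hh_slit ha b x)).1 h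

lemma hasDerivAt_hh (a b x : ℝ) : HasDerivAt (hh a b) (-2 * x * I) x := by
  unfold hh
  have h : HasDerivAt (fun x : ℝ => b - x ^ 2) (-(2 * x)) x := by
    simpa using (hasDerivAt_pow 2 x).const_sub b
  have := ((h.ofReal_comp).mul_const I).const_add (a : ℂ)
  refine HasDerivAt.congr_deriv this ?_
  push_cast; ring

lemma hasDerivAt_lam {a : ℝ} (ha : 0 < a) (b x : ℝ) :
    HasDerivAt (lam a b) (-(x * I) / lam a b x) x := by
  have h := (((hasDerivAt_hh a b x).clog_real (hh_slit ha b x)).div_const 2).cexp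
  refine HasDerivAt.congr_deriv (f := lam a b) h ?_
  change lam a b x * _ = _
  rw [← lam_sq ha]
  have := lam_ne a b x
  field_simp

lemma contDiff_hh (a b : ℝ) : ContDiff ℝ (⊤ : ℕ∞) (hh a b) := by
  unfold hh
  have : ContDiff ℝ (⊤ : ℕ∞) (fun x : ℝ => ((b - x ^ 2 : ℝ) : ℂ)) :=
    Complex.ofRealCLM.contDiff.comp (contDiff_const.sub (contDiff_id.pow 2))
  fun_prop

lemma contDiff_lam {a : ℝ} (ha : 0 < a) (b : ℝ) : ContDiff ℝ (⊤ : ℕ∞) (lam a b) := by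
  unfold lam
  have h1 : ContDiff ℝ (⊤ : ℕ∞) (fun x => Complex.log (hh a b x)) := by
    rw [contDiff_iff_contDiffAt]
    intro x
    have := (Complex.contDiffAt_log (n := (⊤ : ℕ∞)) (hh_slit ha b x)).restrict_scalars ℝ
    exact this.comp x (contDiff_hh a b).contDiffAt
  exact (h1.div_const 2).cexp

lemma lam_facts {a : ℝ} (ha : 0 < a) (b x : ℝ) :
    (lam a b x).re ^ 2 - (lam a b x).im ^ 2 = a ∧
    2 * (lam a b x).re * (lam a b x).im = b - x ^ 2 := by
  have h := lam_sq ha b x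
  have h1 := congrArg Complex.re h
  have h2 := congrArg Complex.im h
  rw [hh_re] at h1
  rw [hh_im] at h2
  simp [sq] at h1 h2
  constructor <;> nlinarith

lemma lam_norm_sq {a : ℝ} (ha : 0 < a) (b x : ℝ) : ‖lam a b x‖ ^ 2 = ‖hh a b x‖ := by
  rw [← lam_sq ha, norm_pow]

lemma hh_norm_ge (a b x : ℝ) : a ≤ ‖hh a b x‖ := by
  have := Complex.re_le_norm (hh a b x)
  rwa [hh_re] at this

lemma hh_norm_ge' (a b x : ℝ) : |b - x ^ 2| ≤ ‖hh a b x‖ := by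
  have := Complex.abs_im_le_norm (hh a b x)
  rwa [hh_im] at this

lemma hh_norm_le {a : ℝ} (ha : 0 < a) (b x : ℝ) : ‖hh a b x‖ ≤ a + |b - x ^ 2| := by
  have := Complex.norm_le_abs_re_add_abs_im (hh a b x)
  rwa [hh_im, hh_re, abs_of_pos ha] at this

/-- `Re λ ≥ √a` -/
lemma lam_re_ge {k : ℝ} (hk : 0 < k) (b x : ℝ) : k ≤ (lam (k ^ 2) b x).re := by
  have := (lam_facts (pow_pos hk 2) b x).1
  have h2 := lam_re_pos (pow_pos hk 2) b x
  nlinarith [sq_nonneg (lam (k ^ 2) b x).im]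

lemma lam_norm_ge {k : ℝ} (hk : 0 < k) (b x : ℝ) : k ≤ ‖lam (k ^ 2) b x‖ :=
  (lam_re_ge hk b x).trans (Complex.re_le_norm _)

lemma lam_im {a : ℝ} (ha : 0 < a) (b x : ℝ) :
    (lam a b x).im = (b - x ^ 2) / (2 * (lam a b x).re) := by
  have := (lam_facts ha b x).2
  have h2 := lam_re_pos ha b x
  field_simp
  linarith

/-! ### L² norm -/

noncomputable def N2 (f : ℝ → ℂ) : ℝ := (eLpNorm f 2 volume).toReal

lemma N2_nonneg (f : ℝ → ℂ) : 0 ≤ N2 f := ENNReal.toReal_nonneg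

lemma N2_sq {f : ℝ → ℂ} (hf : MemLp f 2 volume) : N2 f ^ 2 = ∫ x, ‖f x‖ ^ 2 := by
  unfold N2
  rw [hf.eLpNorm_eq_integral_rpow_norm (by simp) (by simp)]
  simp only [ENNReal.toReal_ofNat, Real.rpow_ofNat]
  have h0 : 0 ≤ ∫ x, ‖f x‖ ^ 2 := integral_nonneg (fun x => by positivity)
  rw [ENNReal.toReal_ofReal (by positivity), ← Real.rpow_natCast, ← Real.rpow_mul h0]
  simp

lemma int_sq {f : ℝ → ℂ} (hf : MemLp f 2 volume) : Integrable (fun x => ‖f x‖ ^ 2) := by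
  simpa using hf.integrable_norm_pow (by simp)

lemma N2_add {f g : ℝ → ℂ} (hf : MemLp f 2 volume) (hg : MemLp g 2 volume) :
    N2 (f + g) ≤ N2 f + N2 g := by
  unfold N2
  rw [← ENNReal.toReal_add hf.2.ne hg.2.ne]
  apply ENNReal.toReal_mono (by simp [hf.2.ne, hg.2.ne])
  exact eLpNorm_add_le hf.1 hg.1 (by simp)

lemma N2_le {f g : ℝ → ℂ} {c : ℝ} (hc : 0 ≤ c) (hf : MemLp f 2 volume) (hg : MemLp g 2 volume)
    (h : ∀ x, ‖f x‖ ≤ c * ‖g x‖) : N2 f ≤ c * N2 g := by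
  apply abs_le_of_sq_le_sq' _ (mul_nonneg hc (N2_nonneg g)) |>.2
  rw [mul_pow, N2_sq hf, N2_sq hg, ← integral_const_mul]
  apply integral_mono (int_sq hf) ((int_sq hg).const_mul _)
  intro x
  have := pow_le_pow_left₀ (norm_nonneg _) (h x) 2
  simpa [mul_pow] using this

lemma memLp_of_decay {f : ℝ → ℂ} (hf : Continuous f) {C : ℝ}
    (h : ∀ x, ‖f x‖ ≤ C * (1 + x ^ 2)⁻¹) : MemLp f 2 volume := by
  rw [memLp_two_iff_integrable_sq_norm hf.aestronglyMeasurable]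
  apply Integrable.mono' ((integrable_inv_one_add_sq).const_mul (C ^ 2)) (by fun_prop)
  refine Filter.Eventually.of_forall fun x => ?_
  have h1 := pow_le_pow_left₀ (norm_nonneg _) (h x) 2
  have h2 : (1 + x ^ 2)⁻¹ ≤ 1 := inv_le_one_of_one_le₀ (by nlinarith)
  have h3 : 0 ≤ (1 + x ^ 2)⁻¹ := by positivity
  rw [Real.norm_of_nonneg (by positivity)]
  refine h1.trans ?_
  rw [mul_pow]
  apply mul_le_mul_of_nonneg_left _ (sq_nonneg C)
  nlinarith

/-- transport estimate -/
lemma transport {P P' G ν : ℝ → ℂ} {κ σ : ℝ} (hκ : 0 < κ) (hσ : σ ^ 2 = 1)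
    (hd : ∀ x, HasDerivAt P (P' x) x) (heq : ∀ x, P' x = ν x * P x + G x)
    (hP : MemLp P 2 volume) (hP' : MemLp P' 2 volume) (hG : MemLp G 2 volume)
    (hν : ∀ x, κ ≤ σ * (ν x).re) : κ * N2 P ≤ N2 G := by
  have hInt1 : Integrable (fun x => (P x).re * (P' x).re + (P x).im * (P' x).im) := by
    exact (hP.re.integrable_mul hP'.re).add (hP.im.integrable_mul hP'.im)
  have hInt2 : Integrable (fun x => (P x).re * (P x).re + (P x).im * (P x).im) := by
    exact (hP.re.integrable_mul hP.re).add (hP.im.integrable_mul hP.im)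
  have hzero : ∫ x, 2 * ((P x).re * (P' x).re + (P x).im * (P' x).im) = 0 := by
    apply integral_eq_zero_of_hasDerivAt_of_integrable
      (f := fun x => (P x).re * (P x).re + (P x).im * (P x).im) _ (hInt1.const_mul 2) hInt2
    intro x
    have hre : HasDerivAt (fun x => (P x).re) (P' x).re x :=
      Complex.reCLM.hasFDerivAt.comp_hasDerivAt x (hd x)
    have him : HasDerivAt (fun x => (P x).im) (P' x).im x :=
      Complex.imCLM.hasFDerivAt.comp_hasDerivAt x (hd x)
    refine HasDerivAt.congr_deriv ((hre.mul hre).add (him.mul him)) ?_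
    ring
  have key : ∀ x, κ ^ 2 * ‖P x‖ ^ 2 ≤
      κ * σ * (2 * ((P x).re * (P' x).re + (P x).im * (P' x).im)) + ‖G x‖ ^ 2 := by
    intro x
    rw [heq x, ← Complex.normSq_eq_norm_sq, ← Complex.normSq_eq_norm_sq,
      Complex.normSq_apply, Complex.normSq_apply]
    simp only [Complex.add_re, Complex.mul_re, Complex.add_im, Complex.mul_im]
    have h1 := hν x
    have h2 : 0 ≤ (σ * (ν x).re - κ) * ((P x).re ^ 2 + (P x).im ^ 2) :=
      mul_nonneg (by linarith) (by positivity)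
    have h3 := mul_nonneg hκ.le h2
    have e1 : ((G x).re + κ * σ * (P x).re) ^ 2 =
      (G x).re ^ 2 + 2 * κ * σ * (P x).re * (G x).re + κ ^ 2 * (P x).re ^ 2 := by
      linear_combination κ ^ 2 * (P x).re ^ 2 * hσ
    have e2 : ((G x).im + κ * σ * (P x).im) ^ 2 =
      (G x).im ^ 2 + 2 * κ * σ * (P x).im * (G x).im + κ ^ 2 * (P x).im ^ 2 := by
      linear_combination κ ^ 2 * (P x).im ^ 2 * hσ
    have e3 := sq_nonneg ((G x).re + κ * σ * (P x).re)
    have e4 := sq_nonneg ((G x).im + κ * σ * (P x).im)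
    nlinarith
  have := integral_mono ((int_sq hP).const_mul (κ ^ 2))
    (((hInt1.const_mul 2).const_mul (κ * σ)).add (int_sq hG)) key
  rw [integral_const_mul, ← N2_sq hP] at this
  simp only [Pi.add_apply] at this
  rw [integral_add ((hInt1.const_mul 2).const_mul (κ * σ)) (int_sq hG), integral_const_mul,
    hzero, ← N2_sq hG] at this
  apply abs_le_of_sq_le_sq' _ (N2_nonneg G) |>.2
  nlinarith


/-! ### Lower bound for `mQ` -/

lemma sch_decay (u : SchwartzMap ℝ ℂ) : ∃ C : ℝ, 0 ≤ C ∧ ∀ x, ‖u x‖ ≤ C * ((1 + x ^ 2)⁻¹) ^ 2 := by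
  obtain ⟨C0, h0, hC0⟩ := u.decay 0 0
  obtain ⟨C4, h4, hC4⟩ := u.decay 4 0
  refine ⟨2 * (C0 + C4), by positivity, fun x => ?_⟩
  have e0 := hC0 x
  have e4 := hC4 x
  simp only [norm_iteratedFDeriv_zero, pow_zero, one_mul] at e0 e4
  have e5 : ‖x‖ ^ 4 = x ^ 4 := by
    rw [Real.norm_eq_abs]; exact (by decide : Even 4).pow_abs x
  rw [e5] at e4
  rw [inv_pow, ← div_eq_mul_inv, le_div_iff₀ (by positivity)]
  have : (1 + x ^ 2) ^ 2 ≤ 2 * (1 + x ^ 4) := by nlinarith [sq_nonneg (1 - x ^ 2)]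
  nlinarith [norm_nonneg (u x), mul_le_mul_of_nonneg_left this (norm_nonneg (u x))]

lemma memLp_sch (u v w : SchwartzMap ℝ ℂ) {F : ℝ → ℂ} (hF : Continuous F) {M : ℝ} (hM : 0 ≤ M)
    (h : ∀ x, ‖F x‖ ≤ M * (1 + x ^ 2) * (‖u x‖ + ‖v x‖ + ‖w x‖)) : MemLp F 2 volume := by
  obtain ⟨C1, h1, hC1⟩ := sch_decay u
  obtain ⟨C2, h2, hC2⟩ := sch_decay v
  obtain ⟨C3, h3, hC3⟩ := sch_decay w
  apply memLp_of_decay hF (C := M * (C1 + C2 + C3))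
  intro x
  refine (h x).trans ?_
  have e1 := hC1 x
  have e2 := hC2 x
  have e3 := hC3 x
  have hx : 0 < 1 + x ^ 2 := by positivity
  calc M * (1 + x ^ 2) * (‖u x‖ + ‖v x‖ + ‖w x‖)
      ≤ M * (1 + x ^ 2) * (C1 * ((1 + x ^ 2)⁻¹) ^ 2 + C2 * ((1 + x ^ 2)⁻¹) ^ 2
        + C3 * ((1 + x ^ 2)⁻¹) ^ 2) := by gcongr
    _ = M * (C1 + C2 + C3) * (1 + x ^ 2)⁻¹ := by field_simp

lemma deriv_compare {f g f' g' : ℝ → ℝ} {c d : ℝ} (hcd : c ≤ d)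
    (hf : ∀ x, HasDerivAt f (f' x) x) (hg : ∀ x, HasDerivAt g (g' x) x)
    (h : ∀ x ∈ Set.Icc c d, f' x ≤ g' x) : f d - f c ≤ g d - g c := by
  have hm : MonotoneOn (fun x => g x - f x) (Set.Icc c d) := by
    apply monotoneOn_of_deriv_nonneg (convex_Icc c d)
    · exact fun x _ => ((hg x).sub (hf x)).continuousAt.continuousWithinAt
    · exact fun x _ => ((hg x).sub (hf x)).differentiableAt.differentiableWithinAt
    · intro x hx
      rw [interior_Icc] at hx
      have : deriv (fun x => g x - f x) x = g' x - f' x := ((hg x).sub (hf x)).deriv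
      rw [this]
      linarith [h x ⟨hx.1.le, hx.2.le⟩]
  have := hm (Set.left_mem_Icc.2 hcd) (Set.right_mem_Icc.2 hcd) hcd
  simp only at this
  linarith

/-- antiderivative of the positive part of `B² - x²` -/
lemma exists_G {B : ℝ} (hB : 0 ≤ B) : ∃ G : ℝ → ℝ,
    (∀ x, HasDerivAt G (max (B ^ 2 - x ^ 2) 0) x) ∧ ∀ x, |G x| ≤ 2 / 3 * B ^ 3 := by
  have hc : Continuous (fun x : ℝ => max (B ^ 2 - x ^ 2) 0) := by fun_prop
  refine ⟨fun x => ∫ t in (0:ℝ)..x, max (B ^ 2 - t ^ 2) 0, fun x =>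
    hc.integral_hasStrictDerivAt 0 x |>.hasDerivAt, ?_⟩
  set G := fun x => ∫ t in (0:ℝ)..x, max (B ^ 2 - t ^ 2) 0 with hG
  have hd : ∀ x, HasDerivAt G (max (B ^ 2 - x ^ 2) 0) x :=
    fun x => hc.integral_hasStrictDerivAt 0 x |>.hasDerivAt
  have hG0 : G 0 = 0 := by simp [hG]
  have hmono : Monotone G := by
    apply monotone_of_hasDerivAt_nonneg hd
    intro x; exact le_max_right _ _
  have hcub : ∀ x, HasDerivAt (fun x : ℝ => B ^ 2 * x - x ^ 3 / 3) (B ^ 2 - x ^ 2) x := by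
    intro x
    refine HasDerivAt.congr_deriv (((hasDerivAt_id x).const_mul (B ^ 2)).sub
      ((hasDerivAt_pow 3 x).div_const 3)) ?_
    simp
  have hconst : ∀ x : ℝ, HasDerivAt (fun _ : ℝ => (0:ℝ)) 0 x := fun x => hasDerivAt_const x 0
  have hGB : G B ≤ 2 / 3 * B ^ 3 := by
    have := deriv_compare hB hd hcub (fun x hx => by
      rw [max_eq_left]; nlinarith [hx.1, hx.2])
    rw [hG0] at this
    nlinarith
  have hGmB : -(2 / 3 * B ^ 3) ≤ G (-B) := by
    have := deriv_compare (c := -B) (d := 0) (by linarith) hd hcub (fun x hx => by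
      rw [max_eq_left]; nlinarith [hx.1, hx.2])
    rw [hG0] at this
    nlinarith
  intro x
  rw [abs_le]
  constructor
  · rcases le_total (-B) x with h | h
    · exact hGmB.trans (hmono h)
    · have := deriv_compare h hd hconst (fun y hy => by
        rw [max_eq_right]; nlinarith [hy.1, hy.2])
      linarith
  · rcases le_total x B with h | h
    · exact (hmono h).trans hGB
    · have := deriv_compare h hd hconst (fun y hy => by
        rw [max_eq_right]; nlinarith [hy.1, hy.2])
      linarith

lemma re_growth {A : ℝ} (hA : 2 ≤ A) {b x : ℝ} (h : 3 * A ^ 2 ≤ x ^ 2 - b) :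
    1 / A ≤ (x ^ 2 - b) / (2 * (lam ((A ^ 3) ^ 2) b x).re) := by
  have hA0 : 0 < A := by linarith
  have hk : 0 < A ^ 3 := by positivity
  set r := (lam ((A ^ 3) ^ 2) b x).re with hr
  have hr0 : 0 < r := hk.trans_le (lam_re_ge hk b x)
  have h1 : r ^ 2 ≤ (A ^ 3) ^ 2 + (x ^ 2 - b) := by
    have h2 : r ≤ ‖lam ((A ^ 3) ^ 2) b x‖ := Complex.re_le_norm _
    have h3 := lam_norm_sq (pow_pos hk 2) b x
    have h4 := hh_norm_le (pow_pos hk 2) b x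
    rw [abs_sub_comm, abs_of_nonneg (by nlinarith)] at h4
    nlinarith
  set t := x ^ 2 - b
  have ht : 0 ≤ t := by nlinarith
  rw [div_le_div_iff₀ hA0 (by positivity), one_mul]
  apply abs_le_of_sq_le_sq' _ (by positivity) |>.2
  have h5 : 4 * A ^ 6 + 4 * t ≤ t ^ 2 * A ^ 2 := by
    have e1 : 12 ≤ 3 * A ^ 2 := by nlinarith
    have e2 : 9 * A ^ 4 ≤ t ^ 2 := by nlinarith
    have e3 : 9 * A ^ 6 ≤ t ^ 2 * A ^ 2 := by nlinarith [sq_nonneg A]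
    have e4 : 48 * t ≤ t ^ 2 * A ^ 2 := by nlinarith [mul_nonneg ht (sq_nonneg A)]
    nlinarith
  nlinarith

lemma exists_weight {A s : ℝ} (hA : 2 ≤ A) (hs : 0 ≤ s) :
    ∃ ψ ψ' : ℝ → ℝ, ∃ M : ℝ, 0 ≤ M ∧ Continuous ψ' ∧ (∀ x, HasDerivAt ψ (ψ' x) x) ∧
      (∀ x, |ψ x| ≤ s ^ 3 / 3 + Real.pi * √(s ^ 2 + 3)) ∧ (∀ x, |ψ' x| ≤ M) ∧
      ∀ x, 1 / A ≤ ψ' x +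
        (x ^ 2 - (A * s) ^ 2) / (2 * (lam ((A ^ 3) ^ 2) ((A * s) ^ 2) x).re) := by
  have hA0 : 0 < A := by linarith
  have hk : 0 < A ^ 3 := by positivity
  obtain ⟨G, hG, hGb⟩ := exists_G (B := A * s) (by positivity)
  set X := A * √(s ^ 2 + 3) with hX
  have hX0 : 0 < X := by positivity
  have hX2 : X ^ 2 = A ^ 2 * (s ^ 2 + 3) := by
    rw [hX, mul_pow, Real.sq_sqrt (by positivity)]
  refine ⟨fun x => G x / (2 * A ^ 3) + 2 * √(s ^ 2 + 3) * Real.arctan (x / X),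
    fun x => max ((A * s) ^ 2 - x ^ 2) 0 / (2 * A ^ 3) +
      2 * √(s ^ 2 + 3) * (1 / (1 + (x / X) ^ 2) * (1 / X)),
    (A * s) ^ 2 / (2 * A ^ 3) + 2 * √(s ^ 2 + 3) * (1 * (1 / X)), by positivity, ?_, ?_, ?_, ?_, ?_⟩
  · have : ∀ x : ℝ, 1 + (x / X) ^ 2 ≠ 0 := fun x => by positivity
    fun_prop (disch := assumption)
  · intro x
    have h1 := (hG x).div_const (2 * A ^ 3)
    have h2 := (((hasDerivAt_id x).div_const X).arctan).const_mul (2 * √(s ^ 2 + 3))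
    exact h1.add h2
  · intro x
    refine (abs_add_le _ _).trans ?_
    apply add_le_add
    · rw [abs_div, abs_of_pos (by positivity : 0 < 2 * A ^ 3), div_le_iff₀ (by positivity)]
      refine (hGb x).trans (le_of_eq ?_)
      ring
    · rw [abs_mul, abs_of_nonneg (by positivity : 0 ≤ 2 * √(s ^ 2 + 3))]
      have : |Real.arctan (x / X)| ≤ Real.pi / 2 :=
        abs_le.2 ⟨(Real.neg_pi_div_two_lt_arctan _).le, (Real.arctan_lt_pi_div_two _).le⟩
      nlinarith [Real.sqrt_nonneg (s ^ 2 + 3)]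
  · intro x
    have hp : 0 ≤ max ((A * s) ^ 2 - x ^ 2) 0 := le_max_right _ _
    rw [abs_of_nonneg (by positivity)]
    have h1 : max ((A * s) ^ 2 - x ^ 2) 0 ≤ (A * s) ^ 2 :=
      max_le (by nlinarith) (by positivity)
    have h2 : 1 / (1 + (x / X) ^ 2) ≤ 1 := by
      rw [div_le_one (by positivity)]; nlinarith [sq_nonneg (x / X)]
    apply add_le_add
    · exact div_le_div_of_nonneg_right h1 (by positivity)
    · exact mul_le_mul_of_nonneg_left (mul_le_mul_of_nonneg_right h2 (by positivity))
        (by positivity)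
  · intro x
    set r := (lam ((A ^ 3) ^ 2) ((A * s) ^ 2) x).re with hr
    have hrk : A ^ 3 ≤ r := lam_re_ge hk _ x
    have hr0 : 0 < r := hk.trans_le hrk
    have hp : 0 ≤ max ((A * s) ^ 2 - x ^ 2) 0 := le_max_right _ _
    by_cases hx : X ^ 2 ≤ x ^ 2
    · have := re_growth hA (b := (A * s) ^ 2) (x := x) (by nlinarith)
      have h2 : 0 ≤ max ((A * s) ^ 2 - x ^ 2) 0 / (2 * A ^ 3) +
        2 * √(s ^ 2 + 3) * (1 / (1 + (x / X) ^ 2) * (1 / X)) := by positivity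
      linarith
    · push Not at hx
      have h1 : 1 / A ≤ 2 * √(s ^ 2 + 3) * (1 / (1 + (x / X) ^ 2) * (1 / X)) := by
        have e1 : (x / X) ^ 2 ≤ 1 := by
          rw [div_pow, div_le_one (by positivity)]; exact hx.le
        have e2 : 1 / 2 ≤ 1 / (1 + (x / X) ^ 2) := by
          apply one_div_le_one_div_of_le (by positivity); linarith
        have e3 : 1 / A = 2 * √(s ^ 2 + 3) * (1 / 2 * (1 / X)) := by
          rw [hX]; field_simp
        rw [e3]; gcongr
      have h2 : ((A * s) ^ 2 - x ^ 2) / (2 * r) ≤ max ((A * s) ^ 2 - x ^ 2) 0 / (2 * A ^ 3) := by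
        apply div_le_div₀ hp (le_max_left _ _) (by positivity) (by linarith)
      have h3 : (x ^ 2 - (A * s) ^ 2) / (2 * r) = - (((A * s) ^ 2 - x ^ 2) / (2 * r)) := by
        rw [← neg_div]; ring
      linarith


lemma lower_core {A s : ℝ} (hA : 2 ≤ A) (hs : 0 ≤ s) (hsA : s ≤ A ^ 2)
    (hK : 4 * Real.exp (2 * (s ^ 3 / 3 + Real.pi * √(s ^ 2 + 3))) ≤ A ^ 2)
    (u v w : SchwartzMap ℝ ℂ) (huv : ∀ x, HasDerivAt u (v x) x) (hvw : ∀ x, HasDerivAt v (w x) x) :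
    2 * N2 u ≤ N2 (fun x => -(w x) - hh ((A ^ 3) ^ 2) ((A * s) ^ 2) x * u x) := by
  have hA0 : 0 < A := by linarith
  have hk : 0 < A ^ 3 := by positivity
  have hk2 : 0 < (A ^ 3) ^ 2 := by positivity
  set b := (A * s) ^ 2 with hb
  set a := (A ^ 3) ^ 2 with ha
  have hba : b ≤ a := by
    have : A * s ≤ A ^ 3 := by nlinarith
    exact pow_le_pow_left₀ (by positivity) this 2
  have hb0 : 0 ≤ b := by positivity
  obtain ⟨ψ, ψ', M, hM, hψc, hψ, hψb, hψ'b, hgrow⟩ := exists_weight hA hs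
  set O := s ^ 3 / 3 + Real.pi * √(s ^ 2 + 3) with hO
  set l := lam a b with hl
  have hlc : Continuous l := (contDiff_lam hk2 b).continuous
  have hl0 : ∀ x, l x ≠ 0 := fun x => lam_ne a b x
  have hhc : Continuous (hh a b) := (contDiff_hh a b).continuous
  have hψcont : Continuous ψ := continuous_iff_continuousAt.2 fun x => (hψ x).continuousAt
  have huc := u.continuous
  have hvc := v.continuous
  have hwc := w.continuous
  -- bounds on l
  have hlk : ∀ x, A ^ 3 ≤ ‖l x‖ := fun x => lam_norm_ge hk b x
  have hxl : ∀ x, x ^ 2 ≤ 2 * ‖l x‖ ^ 2 := by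
    intro x
    have h1 := lam_norm_sq hk2 b x
    have h2 := hh_norm_ge a b x
    have h3 := (neg_abs_le (b - x ^ 2)).trans' (neg_le_neg (hh_norm_ge' a b x))
    change x ^ 2 ≤ 2 * ‖lam a b x‖ ^ 2
    linarith
  set l' : ℝ → ℂ := fun x => -(x * I) / l x with hl'
  have hl'c : Continuous l' := by
    rw [hl']; fun_prop (disch := assumption)
  have hld : ∀ x, HasDerivAt l (l' x) x := fun x => hasDerivAt_lam hk2 b x
  have hl'b : ∀ x, ‖l' x‖ ≤ 2 := by
    intro x
    simp only [hl', norm_div, norm_neg, norm_mul, Complex.norm_I, mul_one, Complex.norm_real,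
      Real.norm_eq_abs]
    have hpos : 0 < ‖l x‖ := norm_pos_iff.2 (hl0 x)
    rw [div_le_iff₀ hpos]
    apply abs_le_of_sq_le_sq _ (by positivity)
    nlinarith [hxl x]
  have hhb : ∀ x, ‖hh a b x‖ ≤ 2 * a * (1 + x ^ 2) := by
    intro x
    have h1 := hh_norm_le hk2 b x
    have h2 : |b - x ^ 2| ≤ b + x ^ 2 := by
      rw [abs_le]; constructor <;> nlinarith
    have h3 : 1 ≤ a := by
      have : 1 ≤ A ^ 3 := one_le_pow₀ (by linarith)
      exact one_le_pow₀ this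
    nlinarith [mul_nonneg (sub_nonneg.2 h3) (sq_nonneg x), sq_nonneg x]
  have ha1 : 1 ≤ a := one_le_pow₀ (one_le_pow₀ (by linarith))
  have hlb : ∀ x, ‖l x‖ ≤ 2 * a * (1 + x ^ 2) := by
    intro x
    refine le_trans ?_ (hhb x)
    rw [← lam_norm_sq hk2 b x]
    have : 1 ≤ ‖l x‖ := (one_le_pow₀ (by linarith)).trans (hlk x)
    change ‖l x‖ ≤ ‖l x‖ ^ 2
    nlinarith
  set f : ℝ → ℂ := fun x => -(w x) - hh a b x * u x with hf
  have hfc : Continuous f := by rw [hf]; fun_prop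
  have hU : MemLp u 2 volume := u.memLp 2 volume
  have hF : MemLp f 2 volume := by
    apply memLp_sch u v w hfc (M := 2 * a) (by positivity)
    intro x
    have h1 : ‖f x‖ ≤ ‖w x‖ + ‖hh a b x‖ * ‖u x‖ := by
      refine (norm_sub_le _ _).trans ?_
      rw [norm_neg, norm_mul]
    have h2 := mul_le_mul_of_nonneg_right (hhb x) (norm_nonneg (u x))
    have h4 : 1 ≤ 2 * a * (1 + x ^ 2) := by nlinarith [sq_nonneg x]
    nlinarith [norm_nonneg (u x), norm_nonneg (v x), norm_nonneg (w x),
      mul_nonneg (sub_nonneg.2 h4) (norm_nonneg (w x)),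
      mul_nonneg (zero_le_one.trans h4) (norm_nonneg (v x))]
  -- the two modes
  have main : ∀ σ : ℝ, σ = 1 ∨ σ = -1 → MemLp (fun x => v x + σ * I * l x * u x) 2 volume ∧
      N2 (fun x => v x + σ * I * l x * u x) ≤ A * Real.exp (2 * O) * (2 * N2 u + N2 f) := by
    intro σ hσ
    have hσ2 : σ ^ 2 = 1 := by rcases hσ with h | h <;> rw [h] <;> norm_num
    have hσn : ‖(σ : ℂ)‖ = 1 := by
      rcases hσ with h | h <;> rw [h] <;> simp
    have hσa : |σ| = 1 := by
      rcases hσ with h | h <;> rw [h] <;> simp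
    have hσ2c : (σ : ℂ) ^ 2 = 1 := by exact_mod_cast congrArg (fun t : ℝ => (t : ℂ)) hσ2
    set p : ℝ → ℂ := fun x => v x + σ * I * l x * u x with hp
    set p' : ℝ → ℂ := fun x => w x + σ * I * (l' x * u x + l x * v x) with hp'
    have hpc : Continuous p := by rw [hp]; fun_prop
    have hp'c : Continuous p' := by rw [hp']; fun_prop
    have hpd : ∀ x, HasDerivAt p (p' x) x := by
      intro x
      have h1 := ((hld x).mul (huv x)).const_mul (σ * I : ℂ)
      refine HasDerivAt.congr_of_eventuallyEq ((hvw x).add h1) (Filter.Eventually.of_forall ?_)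
      intro y
      simp only [hp, Pi.add_apply, Pi.mul_apply]
      ring
    have hpn : ∀ x, ‖p x‖ ≤ ‖v x‖ + ‖l x‖ * ‖u x‖ := by
      intro x
      refine (norm_add_le _ _).trans ?_
      simp [hσa]
    have hp'n : ∀ x, ‖p' x‖ ≤ ‖w x‖ + (2 * ‖u x‖ + ‖l x‖ * ‖v x‖) := by
      intro x
      refine (norm_add_le _ _).trans ?_
      have : ‖(σ : ℂ) * I * (l' x * u x + l x * v x)‖ ≤ 2 * ‖u x‖ + ‖l x‖ * ‖v x‖ := by
        rw [norm_mul, norm_mul, hσn, Complex.norm_I, one_mul, one_mul]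
        refine (norm_add_le _ _).trans ?_
        rw [norm_mul, norm_mul]
        have := mul_le_mul_of_nonneg_right (hl'b x) (norm_nonneg (u x))
        linarith
      linarith
    have hPL : MemLp p 2 volume := by
      apply memLp_sch u v w hpc (M := 2 * a) (by positivity)
      intro x
      have h1 := hpn x
      have h2 := mul_le_mul_of_nonneg_right (hlb x) (norm_nonneg (u x))
      have h4 : 1 ≤ 2 * a * (1 + x ^ 2) := by nlinarith [sq_nonneg x]
      nlinarith [mul_nonneg (sub_nonneg.2 h4) (norm_nonneg (v x)),
        mul_nonneg (zero_le_one.trans h4) (norm_nonneg (w x))]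
    have hPL' : MemLp p' 2 volume := by
      apply memLp_sch u v w hp'c (M := 2 * a) (by positivity)
      intro x
      have h1 := hp'n x
      have h2 := mul_le_mul_of_nonneg_right (hlb x) (norm_nonneg (v x))
      have h4 : 2 ≤ 2 * a * (1 + x ^ 2) := by nlinarith [sq_nonneg x]
      nlinarith [mul_nonneg (sub_nonneg.2 h4) (norm_nonneg (u x)), norm_nonneg (w x),
        mul_nonneg (sub_nonneg.2 h4) (norm_nonneg (w x))]
    refine ⟨hPL, ?_⟩
    -- remainder
    set g : ℝ → ℂ := fun x => σ * I * l' x * u x + -(f x) with hg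
    have hgc : Continuous g := by rw [hg]; fun_prop
    have hl'u : MemLp (fun x => σ * I * l' x * u x) 2 volume := by
      apply memLp_sch u v w (by fun_prop) (M := 2) (by positivity)
      intro x
      rw [norm_mul, norm_mul, norm_mul, hσn, Complex.norm_I, one_mul, one_mul]
      have := mul_le_mul_of_nonneg_right (hl'b x) (norm_nonneg (u x))
      nlinarith [norm_nonneg (u x), norm_nonneg (v x), norm_nonneg (w x), sq_nonneg x,
        mul_nonneg (sq_nonneg x) (norm_nonneg (u x)), mul_nonneg (sq_nonneg x) (norm_nonneg (v x)),
        mul_nonneg (sq_nonneg x) (norm_nonneg (w x))]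
    have hgL : MemLp g 2 volume := hl'u.add hF.neg
    have hgN : N2 g ≤ 2 * N2 u + N2 f := by
      have h1 := N2_add hl'u hF.neg
      have h2 : N2 (fun x => σ * I * l' x * u x) ≤ 2 * N2 u := by
        apply N2_le (by norm_num) hl'u hU
        intro x
        rw [norm_mul, norm_mul, norm_mul, hσn, Complex.norm_I, one_mul, one_mul]
        exact mul_le_mul_of_nonneg_right (hl'b x) (norm_nonneg (u x))
      have h3 : N2 (-f) ≤ 1 * N2 f := by
        apply N2_le (by norm_num) hF.neg hF
        intro x; simp
      have h4 : g = (fun x => σ * I * l' x * u x) + -f := rfl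
      rw [h4]; linarith
    have heq : ∀ x, p' x = σ * I * l x * p x + g x := by
      intro x
      have hsq : l x ^ 2 = hh a b x := lam_sq hk2 b x
      simp only [hp', hp, hg, hf, ← hsq]
      linear_combination (l x ^ 2 * u x * I ^ 2) * (-hσ2c) - (l x ^ 2 * u x) * Complex.I_sq
    -- weighted
    set E : ℝ → ℂ := fun x => ((Real.exp (σ * ψ x) : ℝ) : ℂ) with hE
    have hEc : Continuous E := by rw [hE]; fun_prop
    have hEd : ∀ x, HasDerivAt E (E x * (σ * ψ' x)) x := by
      intro x
      have := (((hψ x).const_mul σ).exp).ofReal_comp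
      refine HasDerivAt.congr_deriv this ?_
      simp only [hE]; push_cast; ring
    have hEn : ∀ x, ‖E x‖ = Real.exp (σ * ψ x) := by
      intro x
      rw [hE, Complex.norm_real, Real.norm_of_nonneg (Real.exp_pos _).le]
    have hEab : ∀ x, |σ * ψ x| ≤ O := by
      intro x; rw [abs_mul, hσa, one_mul]; exact hψb x
    have hEu : ∀ x, ‖E x‖ ≤ Real.exp O := by
      intro x; rw [hEn]; exact Real.exp_le_exp.2 (abs_le.1 (hEab x)).2
    have hEl : ∀ x, 1 ≤ Real.exp O * ‖E x‖ := by
      intro x; rw [hEn, ← Real.exp_add]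
      apply Real.one_le_exp
      linarith [(abs_le.1 (hEab x)).1]
    have hEmul : ∀ {F : ℝ → ℂ}, MemLp F 2 volume → MemLp (fun x => E x * F x) 2 volume := by
      intro F hF
      apply MemLp.of_le_mul (c := Real.exp O) hF (hEc.aestronglyMeasurable.mul hF.1)
      refine Filter.Eventually.of_forall fun x => ?_
      change ‖E x * F x‖ ≤ _
      rw [norm_mul]
      exact mul_le_mul_of_nonneg_right (hEu x) (norm_nonneg _)
    have hψp : MemLp (fun x => (σ * ψ' x : ℂ) * p x) 2 volume := by
      have hc : Continuous (fun x => (σ * ψ' x : ℂ)) := by fun_prop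
      apply MemLp.of_le_mul (c := M) hPL (hc.aestronglyMeasurable.mul hPL.1)
      refine Filter.Eventually.of_forall fun x => ?_
      change ‖(σ * ψ' x : ℂ) * p x‖ ≤ _
      rw [norm_mul, norm_mul, hσn, one_mul, Complex.norm_real]
      exact mul_le_mul_of_nonneg_right (hψ'b x) (norm_nonneg _)
    have htr := transport (P := fun x => E x * p x)
      (P' := fun x => E x * ((σ * ψ' x : ℂ) * p x + p' x))
      (G := fun x => E x * g x) (ν := fun x => σ * I * l x + σ * ψ' x) (κ := 1 / A) (σ := σ)
      (by positivity) hσ2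
      (fun x => by
        refine HasDerivAt.congr_deriv ((hEd x).mul (hpd x)) ?_
        ring)
      (fun x => by simp only [heq x]; ring)
      (hEmul hPL) (hEmul (hψp.add hPL')) (hEmul hgL)
      (fun x => by
        have h1 := hgrow x
        have h2 : ((σ : ℂ) * I * l x + σ * ψ' x).re = σ * (-(l x).im + ψ' x) := by
          simp; ring
        rw [h2, ← mul_assoc, ← sq, hσ2, one_mul]
        have h3 : (l x).im = (b - x ^ 2) / (2 * (l x).re) := lam_im hk2 b x
        have h4 : (x ^ 2 - b) / (2 * (l x).re) = -(l x).im := by rw [h3, ← neg_div]; ring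
        rw [← h4]; linarith)
    have hN1 : N2 p ≤ Real.exp O * N2 (fun x => E x * p x) := by
      apply N2_le (Real.exp_pos _).le hPL (hEmul hPL)
      intro x
      rw [norm_mul, ← mul_assoc]
      have := mul_le_mul_of_nonneg_right (hEl x) (norm_nonneg (p x))
      linarith
    have hN2 : N2 (fun x => E x * g x) ≤ Real.exp O * N2 g := by
      apply N2_le (Real.exp_pos _).le (hEmul hgL) hgL
      intro x
      rw [norm_mul]
      exact mul_le_mul_of_nonneg_right (hEu x) (norm_nonneg _)
    have hN3 : N2 (fun x => E x * p x) ≤ A * N2 (fun x => E x * g x) := by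
      have := mul_le_mul_of_nonneg_left htr hA0.le
      rwa [← mul_assoc, mul_one_div_cancel hA0.ne', one_mul] at this
    have h2O : Real.exp (2 * O) = Real.exp O * Real.exp O := by rw [← Real.exp_add]; ring_nf
    calc N2 p ≤ Real.exp O * N2 (fun x => E x * p x) := hN1
      _ ≤ Real.exp O * (A * (Real.exp O * (2 * N2 u + N2 f))) := by
        have := Real.exp_pos O
        have h5 : N2 (fun x => E x * p x) ≤ A * (Real.exp O * N2 g) :=
          hN3.trans (mul_le_mul_of_nonneg_left hN2 hA0.le)
        refine mul_le_mul_of_nonneg_left (h5.trans ?_) this.le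
        exact mul_le_mul_of_nonneg_left (mul_le_mul_of_nonneg_left hgN this.le) hA0.le
      _ = _ := by rw [h2O]; ring
  obtain ⟨hm1, hn1⟩ := main 1 (Or.inl rfl)
  obtain ⟨hm2, hn2⟩ := main (-1) (Or.inr rfl)
  set p := fun x => v x + ((1:ℝ):ℂ) * I * l x * u x with hp
  set q := fun x => v x + ((-1:ℝ):ℂ) * I * l x * u x with hq
  have hfin : N2 u ≤ 1 / (2 * A ^ 3) * (N2 p + N2 q) := by
    have h1 : N2 u ≤ 1 / (2 * A ^ 3) * N2 (p + -q) := by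
      apply N2_le (by positivity) hU (hm1.add hm2.neg)
      intro x
      have : (p + -q) x = 2 * I * l x * u x := by
        simp only [hp, hq, Pi.add_apply, Pi.neg_apply]; push_cast; ring
      rw [this, norm_mul, norm_mul, norm_mul, Complex.norm_I, one_div, inv_mul_eq_div,
        le_div_iff₀ (by positivity)]
      have h2 := mul_le_mul_of_nonneg_right (hlk x) (norm_nonneg (u x))
      simp only [Complex.norm_ofNat]
      nlinarith
    have h2 := N2_add hm1 hm2.neg
    have h3 : N2 (-q) ≤ 1 * N2 q := by
      apply N2_le (by norm_num) hm2.neg hm2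
      intro x; simp
    refine h1.trans (mul_le_mul_of_nonneg_left ?_ (by positivity))
    linarith
  have h6 : 2 * A ^ 3 * N2 u ≤ N2 p + N2 q := by
    rw [one_div, inv_mul_eq_div, le_div_iff₀ (by positivity)] at hfin
    linarith
  have h7 : 0 ≤ 2 * N2 u + N2 f := by
    have := N2_nonneg u; have := N2_nonneg f; linarith
  have h8 : A * Real.exp (2 * O) * (2 * N2 u + N2 f) ≤ A ^ 3 / 4 * (2 * N2 u + N2 f) := by
    apply mul_le_mul_of_nonneg_right _ h7
    nlinarith
  have h9 : A ^ 3 * (2 * N2 u) ≤ A ^ 3 * ((2 * N2 u + N2 f) / 2) := by linarith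
  have := le_of_mul_le_mul_left h9 hk
  linarith

lemma mQ_lower {A s : ℝ} (hA : 2 ≤ A) (hs : 0 ≤ s) (hsA : s ≤ A ^ 2)
    (hK : 4 * Real.exp (2 * (s ^ 3 / 3 + Real.pi * √(s ^ 2 + 3))) ≤ A ^ 2) {z : ℂ}
    (hre : z.re = (A ^ 3) ^ 2) (him : z.im = (A * s) ^ 2)
    (hne : ∃ u : SchwartzMap ℝ ℂ, u ≠ 0) : 2 ≤ mQ z := by
  obtain ⟨u0, hu0⟩ := hne
  unfold mQ
  refine le_csInf (Set.nonempty_of_mem ⟨u0, hu0, rfl⟩) ?_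
  rintro r ⟨u, hu, rfl⟩
  set v := SchwartzMap.derivCLM ℂ ℂ u with hv
  set w := SchwartzMap.derivCLM ℂ ℂ v with hw
  have huv : ∀ x, HasDerivAt u (v x) x := by
    intro x
    have := (u.differentiable x).hasDerivAt
    simpa [hv] using this
  have hvw : ∀ x, HasDerivAt v (w x) x := by
    intro x
    have := (v.differentiable x).hasDerivAt
    simpa [hw] using this
  have h := lower_core hA hs hsA hK u v w huv hvw
  have hd1 : deriv u = v := funext fun x => (huv x).deriv
  have hd2 : deriv v = w := funext fun x => (hvw x).deriv
  have hz : z = ((A ^ 3) ^ 2 : ℝ) + ((A * s) ^ 2 : ℝ) * I := by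
    rw [← hre, ← him, Complex.re_add_im]
  have hfun : (fun x : ℝ => -(deriv (deriv ⇑u) x) + Complex.I * (x:ℂ) ^ 2 * u x - z * u x)
      = fun x => -(w x) - hh ((A ^ 3) ^ 2) ((A * s) ^ 2) x * u x := by
    funext x
    rw [hd1, hd2, hz, hh]
    push_cast; ring
  rw [hfun]
  have hpos : 0 < N2 u := by
    refine lt_of_le_of_ne (N2_nonneg _) (Ne.symm ?_)
    intro h0
    have hU : MemLp u 2 volume := u.memLp 2 volume
    have h1 : eLpNorm u 2 volume = 0 := by
      rcases (ENNReal.toReal_eq_zero_iff _).1 h0 with h | h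
      · exact h
      · exact absurd h hU.2.ne
    rw [eLpNorm_eq_zero_iff hU.1 (by simp)] at h1
    have h2 := Continuous.ae_eq_iff_eq volume u.continuous continuous_zero |>.1 h1
    exact hu (by ext x; exact congrFun h2 x)
  exact (le_div_iff₀ hpos).2 h


/-! ### Upper bound for `mQ`: a WKB quasimode -/

lemma exists_step : ∃ T T1 T2 : ℝ → ℝ, ∃ C : ℝ, 1 ≤ C ∧ ContDiff ℝ (⊤ : ℕ∞) T ∧
    (∀ x, HasDerivAt T (T1 x) x) ∧ (∀ x, HasDerivAt T1 (T2 x) x) ∧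
    (∀ x, 0 ≤ T x) ∧ (∀ x, T x ≤ 1) ∧ (∀ x, x ≤ 0 → T x = 0) ∧ (∀ x, 1 ≤ x → T x = 1) ∧
    (∀ x, |T1 x| ≤ C) ∧ (∀ x, |T2 x| ≤ C) ∧ (∀ x, x ∉ Set.Icc (0:ℝ) 1 → T1 x = 0 ∧ T2 x = 0) := by
  have hT : ContDiff ℝ (⊤ : ℕ∞) Real.smoothTransition := Real.smoothTransition.contDiff
  have hT1 : ContDiff ℝ (⊤ : ℕ∞) (deriv Real.smoothTransition) := (contDiff_infty_iff_deriv.1 hT).2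
  have hT2 : ContDiff ℝ (⊤ : ℕ∞) (deriv (deriv Real.smoothTransition)) :=
    (contDiff_infty_iff_deriv.1 hT1).2
  have hzero : ∀ x, x ∉ Set.Icc (0:ℝ) 1 →
      deriv Real.smoothTransition x = 0 ∧ deriv (deriv Real.smoothTransition) x = 0 := by
    have key : ∀ U : Set ℝ, IsOpen U → ∀ c : ℝ, (∀ x ∈ U, Real.smoothTransition x = c) →
        ∀ x ∈ U, deriv Real.smoothTransition x = 0 ∧ deriv (deriv Real.smoothTransition) x = 0 := by
      intro U hU c hc
      have h1 : ∀ x ∈ U, deriv Real.smoothTransition x = 0 := by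
        intro x hx
        have : Real.smoothTransition =ᶠ[nhds x] fun _ => c := by
          filter_upwards [hU.mem_nhds hx] with y hy using hc y hy
        rw [this.deriv_eq]; simp
      intro x hx
      refine ⟨h1 x hx, ?_⟩
      have : deriv Real.smoothTransition =ᶠ[nhds x] fun _ => (0:ℝ) := by
        filter_upwards [hU.mem_nhds hx] with y hy using h1 y hy
      rw [this.deriv_eq]; simp
    intro x hx
    by_cases h0 : x < 0
    · exact key (Set.Iio 0) isOpen_Iio 0
        (fun y hy => Real.smoothTransition.zero_of_nonpos (le_of_lt hy)) x h0
    · have h1 : 1 < x := by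
        by_contra h1
        exact hx ⟨not_lt.1 h0, not_lt.1 h1⟩
      exact key (Set.Ioi 1) isOpen_Ioi 1
        (fun y hy => Real.smoothTransition.one_of_one_le (le_of_lt hy)) x h1
  obtain ⟨C1, hC1⟩ := (isCompact_Icc (a := (0:ℝ)) (b := 1)).exists_bound_of_continuousOn
    hT1.continuous.continuousOn
  obtain ⟨C2, hC2⟩ := (isCompact_Icc (a := (0:ℝ)) (b := 1)).exists_bound_of_continuousOn
    hT2.continuous.continuousOn
  have hC : 1 ≤ 1 + |C1| + |C2| := by linarith [abs_nonneg C1, abs_nonneg C2]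
  refine ⟨Real.smoothTransition, deriv Real.smoothTransition, deriv (deriv Real.smoothTransition),
    1 + |C1| + |C2|, hC, hT, ?_, ?_, Real.smoothTransition.nonneg, Real.smoothTransition.le_one,
    fun x hx => Real.smoothTransition.zero_of_nonpos hx,
    fun x hx => Real.smoothTransition.one_of_one_le hx, ?_, ?_, hzero⟩
  · exact fun x => ((contDiff_infty_iff_deriv.1 hT).1 x).hasDerivAt
  · exact fun x => ((contDiff_infty_iff_deriv.1 hT1).1 x).hasDerivAt
  · intro x
    by_cases hx : x ∈ Set.Icc (0:ℝ) 1
    · have := hC1 x hx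
      rw [Real.norm_eq_abs] at this
      linarith [le_abs_self C1, abs_nonneg C2]
    · rw [(hzero x hx).1, abs_zero]; linarith
  · intro x
    by_cases hx : x ∈ Set.Icc (0:ℝ) 1
    · have := hC2 x hx
      rw [Real.norm_eq_abs] at this
      linarith [le_abs_self C2, abs_nonneg C1]
    · rw [(hzero x hx).2, abs_zero]; linarith

noncomputable def phaseD (a b x : ℝ) : ℂ := I * lam a b x + I * x / (2 * hh a b x)

lemma contDiff_phaseD {a : ℝ} (ha : 0 < a) (b : ℝ) : ContDiff ℝ (⊤ : ℕ∞) (phaseD a b) := by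
  unfold phaseD
  have h1 := contDiff_lam ha b
  have h2 := contDiff_hh a b
  have h3 : ContDiff ℝ (⊤ : ℕ∞) (fun x : ℝ => (x : ℂ)) := Complex.ofRealCLM.contDiff
  have h4 : ∀ x, (2 * hh a b x) ≠ 0 := fun x => mul_ne_zero two_ne_zero (hh_ne ha b x)
  simp only [div_eq_mul_inv]
  exact (contDiff_const.mul h1).add
    ((contDiff_const.mul h3).mul ((contDiff_const.mul h2).inv h4))

lemma hasDerivAt_phaseD {a : ℝ} (ha : 0 < a) (b x : ℝ) : HasDerivAt (phaseD a b)
    (-(phaseD a b x) ^ 2 - hh a b x +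
      (I / (2 * hh a b x) - 5 * x ^ 2 / (4 * hh a b x ^ 2))) x := by
  have h0 := hh_ne ha b x
  have hl := lam_ne a b x
  have h1 := (hasDerivAt_lam ha b x).const_mul I
  have h2 := (((hasDerivAt_id x).ofReal_comp).const_mul I).div
    ((hasDerivAt_hh a b x).const_mul 2) (mul_ne_zero two_ne_zero h0)
  refine HasDerivAt.congr_deriv (f := phaseD a b) (h1.add h2) ?_
  have hsq := lam_sq ha b x
  unfold phaseD
  simp only [id]
  rw [← hsq]
  field_simp
  ring_nf
  simp only [Complex.I_sq]
  push_cast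
  ring

lemma phaseD_re {a : ℝ} (ha : 0 < a) (b x : ℝ) : (phaseD a b x).re =
    (x ^ 2 - b) * (1 / (2 * (lam a b x).re) - x / (2 * ‖hh a b x‖ ^ 2)) := by
  have hr := lam_re_pos ha b x
  have hn : 0 < ‖hh a b x‖ := norm_pos_iff.2 (hh_ne ha b x)
  have h1 : (I * x / (2 * hh a b x)).re = x * (b - x ^ 2) / (2 * ‖hh a b x‖ ^ 2) := by
    rw [Complex.div_re, Complex.normSq_eq_norm_sq]
    simp [hh_im, hh_re, mul_pow]
    field_simp
  have h2 : (I * lam a b x).re = - (lam a b x).im := by simp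
  unfold phaseD
  rw [Complex.add_re, h1, h2, lam_im ha]
  field_simp
  ring

lemma exists_phase {a : ℝ} (ha : 0 < a) (b c : ℝ) : ∃ Φ : ℝ → ℂ, Φ c = 0 ∧
    (∀ x, HasDerivAt Φ (phaseD a b x) x) ∧ ContDiff ℝ (⊤ : ℕ∞) Φ := by
  have hc := contDiff_phaseD ha b
  have hd : ∀ x, HasDerivAt (fun x => ∫ t in c..x, phaseD a b t) (phaseD a b x) x :=
    fun x => (hc.continuous.integral_hasStrictDerivAt c x).hasDerivAt
  refine ⟨fun x => ∫ t in c..x, phaseD a b t, by simp, hd, ?_⟩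
  rw [contDiff_infty_iff_deriv]
  refine ⟨fun x => (hd x).differentiableAt, ?_⟩
  have : deriv (fun x => ∫ t in c..x, phaseD a b t) = phaseD a b := funext fun x => (hd x).deriv
  rw [this]; exact hc

set_option maxHeartbeats 2000000 in
/-- bounds on the real part of the phase -/
lemma phase_bounds {A s : ℝ} (hA : 2 ≤ A) (hs : 1 ≤ s) (hsA : s ≤ A ^ 2) {φ : ℝ → ℝ}
    (h0 : φ (-(A * s)) = 0)
    (hd : ∀ x, HasDerivAt φ (phaseD ((A ^ 3) ^ 2) ((A * s) ^ 2) x).re x) :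
    (∀ x ∈ Set.Icc (-(A * s)) (-(A * s) + A / s), -1 ≤ φ x) ∧
    (∀ x ∈ Set.Icc (A * s - A) (A * s),
      φ x ≤ -((1 - s ^ 4 / (8 * A ^ 8) - s / A ^ 8) * (2 / 3 * s ^ 3 - s / 2))) ∧
    (∀ x ∈ Set.Icc (-(4 * (A * s))) (-(3 * (A * s))), φ x ≤ -(10 / 9 * s ^ 3)) := by
  have hA0 : 0 < A := by linarith
  have hs0 : 0 < s := by linarith
  have hk : 0 < A ^ 3 := by positivity
  have hk2 : 0 < (A ^ 3) ^ 2 := by positivity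
  set B := A * s with hB
  have hB0 : 0 < B := by positivity
  have hBk : B ≤ A ^ 3 := by nlinarith
  set a := (A ^ 3) ^ 2 with ha
  have hba : B ^ 2 ≤ a := pow_le_pow_left₀ hB0.le hBk 2
  have hA8 : (1:ℝ) ≤ A ^ 8 := one_le_pow₀ (by linarith)
  have hn : ∀ x, A ^ 12 ≤ ‖hh a (B ^ 2) x‖ ^ 2 := by
    intro x
    have := pow_le_pow_left₀ hk2.le (hh_norm_ge a (B ^ 2) x) 2
    refine le_trans (le_of_eq ?_) this
    rw [ha]; ring
  have hrk : ∀ x, A ^ 3 ≤ (lam a (B ^ 2) x).re := fun x => lam_re_ge hk _ x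
  have hquot : ∀ x y, y ∈ Set.Icc 0 B → y / (2 * ‖hh a (B ^ 2) x‖ ^ 2) ≤ s / A ^ 8 / (2 * A ^ 3) := by
    intro x y hy
    have h1 : y / (2 * ‖hh a (B ^ 2) x‖ ^ 2) ≤ B / (2 * A ^ 12) :=
      div_le_div₀ hB0.le hy.2 (by positivity) (by linarith [hn x])
    refine h1.trans (le_of_eq ?_)
    rw [hB]; field_simp
  refine ⟨?_, ?_, ?_⟩
  · intro x hx
    have hxB : -B + A / s ≤ B := by
      have : A / s ≤ B := by rw [div_le_iff₀ hs0, hB]; nlinarith [mul_nonneg hA0.le hs0.le]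
      linarith
    have hg : ∀ y, HasDerivAt (fun y : ℝ => -(B * (y + B) ^ 2 / A ^ 3))
        (-(B * (2 * (y + B)) / A ^ 3)) y := by
      intro y
      refine HasDerivAt.congr_deriv ((((((hasDerivAt_id y).add_const B).pow 2).const_mul B).div_const
        (A ^ 3)).neg) ?_
      simp
    have := deriv_compare hx.1 hg hd (fun y hy => by
      have hyB : y ≤ B := hy.2.trans (hx.2.trans hxB)
      have hy1 : -B ≤ y := hy.1
      rw [phaseD_re hk2]
      have e1 : 1 / (2 * (lam a (B ^ 2) y).re) ≤ 1 / (2 * A ^ 3) :=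
        one_div_le_one_div_of_le (by positivity) (by linarith [hrk y])
      have e2 : -y / (2 * ‖hh a (B ^ 2) y‖ ^ 2) ≤ 1 / (2 * A ^ 3) := by
        have : -y / (2 * ‖hh a (B ^ 2) y‖ ^ 2) ≤ B / (2 * ‖hh a (B ^ 2) y‖ ^ 2) := by
          apply div_le_div_of_nonneg_right _ (by positivity)
          linarith
        refine (this.trans (hquot y B ⟨hB0.le, le_rfl⟩)).trans ?_
        apply div_le_div_of_nonneg_right _ (by positivity)
        rw [div_le_one (by positivity)]
        refine hsA.trans ?_
        exact pow_le_pow_right₀ (by linarith) (by norm_num)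
      have e3 : 0 ≤ B ^ 2 - y ^ 2 := by nlinarith
      have e4 : B ^ 2 - y ^ 2 ≤ 2 * B * (y + B) := by nlinarith
      have e5 : 1 / (2 * (lam a (B ^ 2) y).re) - y / (2 * ‖hh a (B ^ 2) y‖ ^ 2) ≤ 1 / A ^ 3 := by
        have : 1 / A ^ 3 = 1 / (2 * A ^ 3) + 1 / (2 * A ^ 3) := by field_simp; norm_num
        rw [neg_div] at e2
        linarith
      have e6 := mul_le_mul_of_nonneg_left e5 e3
      have e7 : (B ^ 2 - y ^ 2) * (1 / A ^ 3) ≤ B * (2 * (y + B)) / A ^ 3 := by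
        rw [mul_one_div]
        apply div_le_div_of_nonneg_right _ hk.le
        linarith
      nlinarith)
    rw [h0] at this
    have h2 : B * (x + B) ^ 2 / A ^ 3 ≤ 1 := by
      rw [div_le_one hk]
      have e1 : 0 ≤ x + B := by linarith [hx.1]
      have e2 : x + B ≤ A / s := by linarith [hx.2]
      have e3 := pow_le_pow_left₀ e1 e2 2
      calc B * (x + B) ^ 2 ≤ B * (A / s) ^ 2 := mul_le_mul_of_nonneg_left e3 hB0.le
        _ = A ^ 3 / s := by rw [hB]; field_simp
        _ ≤ A ^ 3 := div_le_self hk.le hs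
    simp only [neg_add_cancel] at this
    simp at this
    linarith
  · intro x hx
    set θ := 1 - s ^ 4 / (8 * A ^ 8) - s / A ^ 8 with hθ
    have hxB : -B ≤ x := by
      have := hx.1
      nlinarith
    have hθ0 : 0 ≤ θ := by
      have h4 : s ^ 4 ≤ (A ^ 2) ^ 4 := pow_le_pow_left₀ hs0.le hsA 4
      have e1 : s ^ 4 / (8 * A ^ 8) ≤ 1 / 8 := by
        rw [div_le_div_iff₀ (by positivity) (by norm_num)]; nlinarith
      have e2 : s / A ^ 8 ≤ 1 / 2 := by
        rw [div_le_div_iff₀ (by positivity) (by norm_num)]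
        have : A ^ 8 = A ^ 2 * A ^ 6 := by ring
        have h6 : 2 ≤ A ^ 6 := by
          have := pow_le_pow_left₀ (by norm_num) hA 6
          norm_num at this; linarith
        nlinarith [sq_nonneg A]
      rw [hθ]; linarith
    have hg : ∀ y, HasDerivAt (fun y : ℝ => -(θ / (2 * A ^ 3) * (B ^ 2 * y - y ^ 3 / 3)))
        (-(θ / (2 * A ^ 3) * (B ^ 2 - y ^ 2))) y := by
      intro y
      refine HasDerivAt.congr_deriv (((((hasDerivAt_id y).const_mul (B ^ 2)).sub
        ((hasDerivAt_pow 3 y).div_const 3)).const_mul (θ / (2 * A ^ 3))).neg) ?_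
      simp
    have := deriv_compare hxB hd hg (fun y hy => by
      have hyB : y ≤ B := hy.2.trans hx.2
      have hy1 : -B ≤ y := hy.1
      rw [phaseD_re hk2]
      have e3 : 0 ≤ B ^ 2 - y ^ 2 := by nlinarith
      set r := (lam a (B ^ 2) y).re with hr
      have hr1 : A ^ 3 ≤ r := hrk y
      have hr0 : 0 < r := hk.trans_le hr1
      have hrsq : r ^ 2 - (lam a (B ^ 2) y).im ^ 2 = (A ^ 3) ^ 2 := (lam_facts hk2 (B ^ 2) y).1
      have him : (lam a (B ^ 2) y).im = (B ^ 2 - y ^ 2) / (2 * r) := lam_im hk2 (B ^ 2) y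
      have him2 : (lam a (B ^ 2) y).im ≤ B ^ 2 / (2 * A ^ 3) := by
        rw [him]
        exact div_le_div₀ (by positivity) (by nlinarith) (by positivity) (by linarith)
      have him0 : 0 ≤ (lam a (B ^ 2) y).im := by rw [him]; positivity
      have him3 := pow_le_pow_left₀ him0 him2 2
      set t := s ^ 4 / (8 * A ^ 8) with ht
      have ht0 : 0 ≤ t := by positivity
      have hBt : (B ^ 2 / (2 * A ^ 3)) ^ 2 = (A ^ 3) ^ 2 * (2 * t) := by
        rw [hB, ht]; field_simp; ring
      have hrt : r ≤ A ^ 3 * (1 + t) := by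
        apply abs_le_of_sq_le_sq' _ (by positivity) |>.2
        nlinarith [mul_nonneg (sq_nonneg (A ^ 3)) (sq_nonneg t)]
      have e1 : (1 - t) / (2 * A ^ 3) ≤ 1 / (2 * r) := by
        rw [div_le_div_iff₀ (by positivity) (by positivity)]
        by_cases h1t : t ≤ 1
        · nlinarith [mul_le_mul_of_nonneg_left hrt (sub_nonneg.2 h1t),
            mul_nonneg hk.le (sq_nonneg t)]
        · nlinarith
      have e2 : y / (2 * ‖hh a (B ^ 2) y‖ ^ 2) ≤ s / A ^ 8 / (2 * A ^ 3) := by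
        have : y / (2 * ‖hh a (B ^ 2) y‖ ^ 2) ≤ B / (2 * ‖hh a (B ^ 2) y‖ ^ 2) :=
          div_le_div_of_nonneg_right hyB (by positivity)
        exact this.trans (hquot y B ⟨hB0.le, le_rfl⟩)
      have e5 : θ / (2 * A ^ 3) ≤ 1 / (2 * r) - y / (2 * ‖hh a (B ^ 2) y‖ ^ 2) := by
        have : θ / (2 * A ^ 3) = (1 - t) / (2 * A ^ 3) - s / A ^ 8 / (2 * A ^ 3) := by
          rw [hθ, ← sub_div]
        linarith
      have e6 := mul_le_mul_of_nonneg_right e5 e3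
      nlinarith)
    rw [h0] at this
    have e1 : 2 * A ^ 3 * (2 / 3 * s ^ 3 - s / 2) ≤
        (B ^ 2 * x - x ^ 3 / 3) - (B ^ 2 * (-B) - (-B) ^ 3 / 3) := by
      have hy0 : 0 ≤ B - x := by linarith [hx.2]
      have hyA : B - x ≤ A := by linarith [hx.1]
      have e2 : (B - x) ^ 2 ≤ A ^ 2 := pow_le_pow_left₀ hy0 hyA 2
      have e3 : (B ^ 2 * x - x ^ 3 / 3) - (B ^ 2 * (-B) - (-B) ^ 3 / 3) =
        4 / 3 * B ^ 3 - (B * (B - x) ^ 2 - (B - x) ^ 3 / 3) := by ring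
      have e4 : 2 * A ^ 3 * (2 / 3 * s ^ 3 - s / 2) = 4 / 3 * B ^ 3 - B * A ^ 2 := by
        rw [hB]; ring
      rw [e3, e4]
      have := mul_le_mul_of_nonneg_left e2 hB0.le
      have := pow_nonneg hy0 3
      linarith
    have e2 := mul_le_mul_of_nonneg_left e1 (by positivity : 0 ≤ θ / (2 * A ^ 3))
    have e3 : θ / (2 * A ^ 3) * (2 * A ^ 3 * (2 / 3 * s ^ 3 - s / 2)) =
      θ * (2 / 3 * s ^ 3 - s / 2) := by field_simp
    rw [e3] at e2
    linarith
  · intro x hx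
    have hxB : x ≤ -B := by linarith [hx.2]
    have hg : ∀ y, HasDerivAt (fun y : ℝ => 1 / (6 * A ^ 3) * (y ^ 3 / 3 - B ^ 2 * y))
        (1 / (6 * A ^ 3) * (y ^ 2 - B ^ 2)) y := by
      intro y
      refine HasDerivAt.congr_deriv ((((hasDerivAt_pow 3 y).div_const 3).sub
        ((hasDerivAt_id y).const_mul (B ^ 2))).const_mul (1 / (6 * A ^ 3))) ?_
      simp
    have := deriv_compare hxB hg hd (fun y hy => by
      have hyB : -(4 * B) ≤ y := hx.1.trans hy.1
      have hy1 : y ≤ -B := hy.2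
      rw [phaseD_re hk2]
      have e3 : 0 ≤ y ^ 2 - B ^ 2 := by nlinarith
      set r := (lam a (B ^ 2) y).re with hr
      have hr1 : A ^ 3 ≤ r := hrk y
      have hr0 : 0 < r := hk.trans_le hr1
      have hrsq : r ^ 2 - (lam a (B ^ 2) y).im ^ 2 = (A ^ 3) ^ 2 := (lam_facts hk2 (B ^ 2) y).1
      have hnsq : r * r + (lam a (B ^ 2) y).im * (lam a (B ^ 2) y).im = ‖hh a (B ^ 2) y‖ := by
        rw [← lam_norm_sq hk2, ← Complex.normSq_eq_norm_sq, Complex.normSq_apply]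
      have hle := hh_norm_le hk2 (B ^ 2) y
      rw [abs_sub_comm, abs_of_nonneg e3] at hle
      have hr3 : r ≤ 3 * A ^ 3 := by
        apply abs_le_of_sq_le_sq' _ (by positivity) |>.2
        nlinarith
      have e1 : 1 / (6 * A ^ 3) ≤ 1 / (2 * r) :=
        one_div_le_one_div_of_le (by positivity) (by linarith)
      have e2 : y / (2 * ‖hh a (B ^ 2) y‖ ^ 2) ≤ 0 :=
        div_nonpos_of_nonpos_of_nonneg (by linarith) (by positivity)
      rw [mul_comm]
      exact mul_le_mul_of_nonneg_left (by linarith) e3)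
    rw [h0] at this
    have e1 : x ^ 3 / 3 - B ^ 2 * x - ((-B) ^ 3 / 3 - B ^ 2 * (-B)) ≤ -(20 / 3 * B ^ 3) := by
      have : 0 ≤ -(3 * B) - x := by linarith [hx.2]
      have e2 : x ^ 3 / 3 - B ^ 2 * x - ((-B) ^ 3 / 3 - B ^ 2 * (-B)) + 20 / 3 * B ^ 3 =
        -((-(3 * B) - x) ^ 3 / 3 + 3 * B * (-(3 * B) - x) ^ 2 + 8 * B ^ 2 * (-(3 * B) - x)) := by
        ring
      have : 0 ≤ (-(3 * B) - x) ^ 3 / 3 + 3 * B * (-(3 * B) - x) ^ 2 + 8 * B ^ 2 * (-(3 * B) - x) := by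
        positivity
      linarith
    have e2 := mul_le_mul_of_nonneg_left e1 (by positivity : 0 ≤ 1 / (6 * A ^ 3))
    have e3 : 1 / (6 * A ^ 3) * -(20 / 3 * B ^ 3) = -(10 / 9 * s ^ 3) := by
      rw [hB]; field_simp; norm_num
    rw [e3] at e2
    linarith


lemma norm_rem {a b x : ℝ} (ha : 0 < a) (hba : b ≤ a) :
    ‖I / (2 * hh a b x) - 5 * x ^ 2 / (4 * hh a b x ^ 2)‖ ≤ 3 / a := by
  have hn : a ≤ ‖hh a b x‖ := hh_norm_ge a b x
  have hx : x ^ 2 ≤ 2 * ‖hh a b x‖ := by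
    have h3 := (neg_abs_le (b - x ^ 2)).trans' (neg_le_neg (hh_norm_ge' a b x))
    linarith
  set n := ‖hh a b x‖ with hn'
  have hn0 : 0 < n := ha.trans_le hn
  refine (norm_sub_le _ _).trans ?_
  have e1 : ‖I / (2 * hh a b x)‖ = 1 / (2 * n) := by simp [← hn']
  have e2 : ‖(5 * x ^ 2 / (4 * hh a b x ^ 2) : ℂ)‖ = 5 * x ^ 2 / (4 * n ^ 2) := by
    simp [← hn']
  rw [e1, e2]
  have e3 : 5 * x ^ 2 / (4 * n ^ 2) ≤ 5 * (2 * n) / (4 * n ^ 2) :=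
    div_le_div_of_nonneg_right (by linarith) (by positivity)
  have e4 : 5 * (2 * n) / (4 * n ^ 2) + 1 / (2 * n) = 3 / n := by field_simp; norm_num
  have e5 : 3 / n ≤ 3 / a := div_le_div_of_nonneg_left (by norm_num) ha hn
  linarith

set_option maxHeartbeats 2000000 in
lemma mQ_upper : ∃ C : ℝ, 0 < C ∧ ∀ A s E : ℝ, 2 ≤ A → 1 ≤ s → s ≤ A ^ 2 →
    E ≤ (1 - s ^ 4 / (8 * A ^ 8) - s / A ^ 8) * (2 / 3 * s ^ 3 - s / 2) →
    E ≤ 10 / 9 * s ^ 3 → ∀ z : ℂ, z.re = (A ^ 3) ^ 2 → z.im = (A * s) ^ 2 →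
    mQ z ≤ 3 / A ^ 6 + C * A ^ 2 * s * Real.exp (-E) := by
  obtain ⟨T, T1, T2, C, hC, hTc, hT, hT1, hT0, hTle, hTz, hTo, hb1, hb2, hsupp⟩ := exists_step
  refine ⟨112 * C ^ 2, by positivity, ?_⟩
  intro A s E hA hs hsA hE1 hE2 z hre him
  have hA0 : 0 < A := by linarith
  have hs0 : 0 < s := by linarith
  have hk : 0 < A ^ 3 := by positivity
  have hk1 : 1 ≤ A ^ 3 := one_le_pow₀ (by linarith)
  have hk2 : 0 < (A ^ 3) ^ 2 := by positivity
  set B := A * s with hB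
  have hB0 : 0 < B := by positivity
  have hBA : A ≤ B := by nlinarith
  have hBk : B ≤ A ^ 3 := by nlinarith
  set a := (A ^ 3) ^ 2 with ha
  have hba : B ^ 2 ≤ a := pow_le_pow_left₀ hB0.le hBk 2
  obtain ⟨Φ, hΦ0, hΦd, hΦc⟩ := exists_phase hk2 (B ^ 2) (-B)
  have hφd : ∀ x, HasDerivAt (fun x => (Φ x).re) (phaseD a (B ^ 2) x).re x := fun x =>
    Complex.reCLM.hasFDerivAt.comp_hasDerivAt x (hΦd x)
  obtain ⟨hp1, hp2, hp3⟩ := phase_bounds hA hs hsA (φ := fun x => (Φ x).re)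
    (by simp only [← hB, hΦ0, Complex.zero_re]) hφd
  simp only [← hB] at hp1 hp2 hp3
  set F := phaseD a (B ^ 2) with hF
  have hFc : Continuous F := (contDiff_phaseD hk2 (B ^ 2)).continuous
  set Rm : ℝ → ℂ := fun x => I / (2 * hh a (B ^ 2) x) - 5 * x ^ 2 / (4 * hh a (B ^ 2) x ^ 2) with hRm
  have hFd : ∀ x, HasDerivAt F (-(F x) ^ 2 - hh a (B ^ 2) x + Rm x) x :=
    fun x => hasDerivAt_phaseD hk2 (B ^ 2) x
  have hRb : ∀ x, ‖Rm x‖ ≤ 3 / a := fun x => norm_rem hk2 hba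
  -- cutoff
  set χ : ℝ → ℝ := fun x => T ((B - x) / A) * T ((x + 4 * B) / A) with hχ
  set χ1 : ℝ → ℝ := fun x => (-(T1 ((B - x) / A)) * T ((x + 4 * B) / A) +
    T ((B - x) / A) * T1 ((x + 4 * B) / A)) / A with hχ1
  set χ2 : ℝ → ℝ := fun x => (T2 ((B - x) / A) * T ((x + 4 * B) / A)
    - 2 * T1 ((B - x) / A) * T1 ((x + 4 * B) / A)
    + T ((B - x) / A) * T2 ((x + 4 * B) / A)) / A ^ 2 with hχ2
  have hy1 : ∀ x : ℝ, HasDerivAt (fun x : ℝ => (B - x) / A) (-1 / A) x := fun x =>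
    ((hasDerivAt_id x).const_sub B).div_const A
  have hy2 : ∀ x : ℝ, HasDerivAt (fun x : ℝ => (x + 4 * B) / A) (1 / A) x := fun x =>
    ((hasDerivAt_id x).add_const (4 * B)).div_const A
  have hTy1 : ∀ x, HasDerivAt (fun x : ℝ => T ((B - x) / A)) (T1 ((B - x) / A) * (-1 / A)) x :=
    fun x => HasDerivAt.comp x (hT _) (hy1 x)
  have hTy2 : ∀ x, HasDerivAt (fun x : ℝ => T ((x + 4 * B) / A)) (T1 ((x + 4 * B) / A) * (1 / A)) x :=
    fun x => HasDerivAt.comp x (hT _) (hy2 x)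
  have hT1y1 : ∀ x, HasDerivAt (fun x : ℝ => T1 ((B - x) / A)) (T2 ((B - x) / A) * (-1 / A)) x :=
    fun x => HasDerivAt.comp x (hT1 _) (hy1 x)
  have hT1y2 : ∀ x, HasDerivAt (fun x : ℝ => T1 ((x + 4 * B) / A))
      (T2 ((x + 4 * B) / A) * (1 / A)) x := fun x => HasDerivAt.comp x (hT1 _) (hy2 x)
  have hχd : ∀ x, HasDerivAt χ (χ1 x) x := by
    intro x
    refine HasDerivAt.congr_deriv ((hTy1 x).mul (hTy2 x)) ?_
    simp only [hχ1]; field_simp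
  have hχ1d : ∀ x, HasDerivAt χ1 (χ2 x) x := by
    intro x
    refine HasDerivAt.congr_deriv ((((hT1y1 x).neg.mul (hTy2 x)).add
      ((hTy1 x).mul (hT1y2 x))).div_const A) ?_
    simp only [hχ2, Pi.neg_apply]; field_simp; ring
  have hχs : ContDiff ℝ (⊤ : ℕ∞) χ := by
    have e1 : ContDiff ℝ (⊤ : ℕ∞) (fun x : ℝ => (B - x) / A) :=
      (contDiff_const.sub contDiff_id).div_const A
    have e2 : ContDiff ℝ (⊤ : ℕ∞) (fun x : ℝ => (x + 4 * B) / A) :=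
      (contDiff_id.add contDiff_const).div_const A
    exact (hTc.comp e1).mul (hTc.comp e2)
  -- quasimode
  set u0 : ℝ → ℂ := fun x => (χ x : ℂ) * Complex.exp (Φ x) with hu0
  have hu0s : ContDiff ℝ (⊤ : ℕ∞) u0 :=
    (Complex.ofRealCLM.contDiff.comp hχs).mul hΦc.cexp
  have hu0c : HasCompactSupport u0 := by
    apply HasCompactSupport.intro (isCompact_Icc (a := -(4 * B)) (b := B))
    intro x hx
    have : χ x = 0 := by
      rw [Set.mem_Icc, not_and_or, not_le, not_le] at hx
      rcases hx with h | h
      · have : T ((x + 4 * B) / A) = 0 :=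
          hTz _ (div_nonpos_of_nonpos_of_nonneg (by linarith) hA0.le)
        simp [hχ, this]
      · have : T ((B - x) / A) = 0 :=
          hTz _ (div_nonpos_of_nonpos_of_nonneg (by linarith) hA0.le)
        simp [hχ, this]
    simp [hu0, this]
  set u : SchwartzMap ℝ ℂ := hu0c.toSchwartzMap hu0s with hu
  have hucoe : (u : ℝ → ℂ) = u0 := rfl
  have hed : ∀ x, HasDerivAt (fun x => Complex.exp (Φ x)) (Complex.exp (Φ x) * F x) x :=
    fun x => (hΦd x).cexp
  have hu0d : ∀ x, HasDerivAt u0 (((χ1 x : ℂ) + χ x * F x) * Complex.exp (Φ x)) x := by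
    intro x
    refine HasDerivAt.congr_deriv (((hχd x).ofReal_comp).mul (hed x)) ?_
    ring
  have hu1d : ∀ x, HasDerivAt (fun x => ((χ1 x : ℂ) + χ x * F x) * Complex.exp (Φ x))
      (((χ2 x : ℂ) + 2 * χ1 x * F x + χ x * (-hh a (B ^ 2) x + Rm x)) * Complex.exp (Φ x)) x := by
    intro x
    refine HasDerivAt.congr_deriv ((((hχ1d x).ofReal_comp).add
      (((hχd x).ofReal_comp).mul (hFd x))).mul (hed x)) ?_
    simp only [Pi.add_apply, Pi.mul_apply]
    ring
  have hz : z = (a : ℝ) + (B ^ 2 : ℝ) * I := by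
    rw [← hre, ← him, Complex.re_add_im]
  set cut : ℝ → ℂ := fun x => ((χ2 x : ℂ) + 2 * χ1 x * F x) * Complex.exp (Φ x) with hcut
  have hfun : (fun x : ℝ => -(deriv (deriv ⇑u) x) + Complex.I * (x:ℂ) ^ 2 * u x - z * u x)
      = -cut + fun x => -(Rm x * u0 x) := by
    have hd1 : deriv u0 = fun x => ((χ1 x : ℂ) + χ x * F x) * Complex.exp (Φ x) :=
      funext fun x => (hu0d x).deriv
    funext x
    rw [hucoe, hd1, (hu1d x).deriv, hz, hh]
    simp only [Pi.add_apply, Pi.neg_apply, hcut, hu0]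
    push_cast; ring
  -- integrability
  have hU : MemLp u0 2 volume := u.memLp 2 volume
  have hRc : Continuous Rm := by
    have h1 := (contDiff_hh a (B ^ 2)).continuous
    have h2 : ∀ x, 2 * hh a (B ^ 2) x ≠ 0 := fun x => mul_ne_zero two_ne_zero (hh_ne hk2 _ x)
    have h3 : ∀ x, 4 * hh a (B ^ 2) x ^ 2 ≠ 0 :=
      fun x => mul_ne_zero (by norm_num) (pow_ne_zero 2 (hh_ne hk2 _ x))
    exact (continuous_const.div (by fun_prop) h2).sub (Continuous.div (by fun_prop) (by fun_prop) h3)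
  have hRu : MemLp (fun x => -(Rm x * u0 x)) 2 volume := by
    apply MemLp.of_le_mul (c := 3 / a) hU (hRc.aestronglyMeasurable.mul hU.1).neg
    refine Filter.Eventually.of_forall fun x => ?_
    change ‖-(Rm x * u0 x)‖ ≤ _
    rw [norm_neg, norm_mul]
    exact mul_le_mul_of_nonneg_right (hRb x) (norm_nonneg _)
  set D := Set.Icc (-(4 * B)) (-(4 * B) + A) ∪ Set.Icc (B - A) B with hD
  have hDm : MeasurableSet D := measurableSet_Icc.union measurableSet_Icc
  have hDv : volume D ≤ ENNReal.ofReal (2 * A) := by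
    refine (measure_union_le _ _).trans ?_
    rw [Real.volume_Icc, Real.volume_Icc, ← ENNReal.ofReal_add (by linarith) (by linarith)]
    apply ENNReal.ofReal_le_ofReal; linarith
  set M := 28 * C ^ 2 * A ^ 2 * Real.exp (-E) with hM
  have hM0 : 0 < M := by positivity
  have hcutz : ∀ x, x ∉ D → cut x = 0 := by
    intro x hx
    have h1 : (B - x) / A ∉ Set.Icc (0:ℝ) 1 := by
      intro h
      apply hx; right
      have e1 := h.1
      have e2 := h.2
      rw [div_le_one hA0] at e2
      have e3 := mul_nonneg e1 hA0.le
      rw [div_mul_cancel₀ _ hA0.ne'] at e3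
      exact ⟨by linarith, by linarith⟩
    have h2 : (x + 4 * B) / A ∉ Set.Icc (0:ℝ) 1 := by
      intro h
      apply hx; left
      have e1 := h.1
      have e2 := h.2
      rw [div_le_one hA0] at e2
      have e3 := mul_nonneg e1 hA0.le
      rw [div_mul_cancel₀ _ hA0.ne'] at e3
      exact ⟨by linarith, by linarith⟩
    simp [hcut, hχ1, hχ2, (hsupp _ h1).1, (hsupp _ h1).2, (hsupp _ h2).1, (hsupp _ h2).2]
  have hcutb : ∀ x, x ∈ D → ‖cut x‖ ≤ M := by
    intro x hx
    have hxr : -(4 * B) ≤ x ∧ x ≤ B := by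
      rcases hx with h | h
      · exact ⟨h.1, by linarith [h.2]⟩
      · exact ⟨by linarith [h.1], h.2⟩
    have hre : (Φ x).re ≤ -E := by
      rcases hx with h | h
      · exact (hp3 x ⟨h.1, by linarith [h.2]⟩).trans (by linarith)
      · exact (hp2 x h).trans (by linarith)
    have hex : ‖Complex.exp (Φ x)‖ ≤ Real.exp (-E) := by
      rw [Complex.norm_exp]; exact Real.exp_le_exp.2 hre
    have hx2 : x ^ 2 ≤ 16 * B ^ 2 := by nlinarith [hxr.1, hxr.2]
    have hFb : ‖F x‖ ≤ 6 * A ^ 3 := by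
      have hn : a ≤ ‖hh a (B ^ 2) x‖ := hh_norm_ge a _ x
      have hlam : ‖lam a (B ^ 2) x‖ ≤ 4 * A ^ 3 := by
        apply abs_le_of_sq_le_sq' _ (by positivity) |>.2
        rw [lam_norm_sq hk2]
        have h1 := hh_norm_le hk2 (B ^ 2) x
        have h2 : |B ^ 2 - x ^ 2| ≤ 15 * a := by
          rw [abs_le]; constructor <;> nlinarith [sq_nonneg x]
        nlinarith
      have h2 : ‖I * x / (2 * hh a (B ^ 2) x)‖ ≤ 2 * A ^ 3 := by
        rw [norm_div, norm_mul, norm_mul, Complex.norm_I, one_mul, Complex.norm_real,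
          Real.norm_eq_abs, Complex.norm_ofNat, div_le_iff₀ (by linarith)]
        have h3 : |x| ≤ 4 * A ^ 3 := by
          rw [abs_le]; constructor <;> linarith [hxr.1, hxr.2]
        have h4 : 1 ≤ a := one_le_pow₀ hk1
        have h5 : 1 ≤ ‖hh a (B ^ 2) x‖ := h4.trans hn
        nlinarith
      calc ‖F x‖ ≤ ‖I * lam a (B ^ 2) x‖ + ‖I * x / (2 * hh a (B ^ 2) x)‖ := norm_add_le _ _
        _ ≤ 4 * A ^ 3 + 2 * A ^ 3 := by
          apply add_le_add _ h2
          rw [norm_mul, Complex.norm_I, one_mul]; exact hlam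
        _ = 6 * A ^ 3 := by ring
    have hTa : ∀ y, |T y| ≤ 1 := fun y => abs_le.2 ⟨by linarith [hT0 y], hTle y⟩
    have hc1 : |χ1 x| ≤ 2 * C / A := by
      simp only [hχ1]
      rw [abs_div, abs_of_pos hA0]
      apply div_le_div_of_nonneg_right _ hA0.le
      refine (abs_add_le _ _).trans ?_
      rw [abs_mul, abs_mul, abs_neg]
      have e1 := mul_le_mul (hb1 ((B - x) / A)) (hTa ((x + 4 * B) / A)) (abs_nonneg _) (by linarith)
      have e2 := mul_le_mul (hTa ((B - x) / A)) (hb1 ((x + 4 * B) / A)) (abs_nonneg _) (by linarith)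
      linarith
    have hc2 : |χ2 x| ≤ 4 * C ^ 2 / A ^ 2 := by
      simp only [hχ2]
      rw [abs_div, abs_of_pos (pow_pos hA0 2)]
      apply div_le_div_of_nonneg_right _ (by positivity)
      refine (abs_add_le _ _).trans ?_
      have e0 := abs_sub (T2 ((B - x) / A) * T ((x + 4 * B) / A))
        (2 * T1 ((B - x) / A) * T1 ((x + 4 * B) / A))
      rw [abs_mul, abs_mul, abs_mul, abs_two] at e0
      rw [abs_mul (T ((B - x) / A))]
      have e1 := mul_le_mul (hb2 ((B - x) / A)) (hTa ((x + 4 * B) / A)) (abs_nonneg _) (by linarith)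
      have e2 := mul_le_mul (hTa ((B - x) / A)) (hb2 ((x + 4 * B) / A)) (abs_nonneg _) (by linarith)
      have e3 := mul_le_mul (hb1 ((B - x) / A)) (hb1 ((x + 4 * B) / A)) (abs_nonneg _) (by linarith)
      nlinarith
    have hc1' : 2 * |χ1 x| * ‖F x‖ ≤ 24 * C * A ^ 2 := by
      calc 2 * |χ1 x| * ‖F x‖ ≤ 2 * (2 * C / A) * (6 * A ^ 3) := by gcongr
        _ = 24 * C * A ^ 2 := by field_simp; norm_num
    have hc2' : |χ2 x| ≤ 4 * C ^ 2 * A ^ 2 := by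
      refine hc2.trans ?_
      rw [div_le_iff₀ (by positivity)]
      have e1 : 1 ≤ A ^ 2 * A ^ 2 := by
        have : 1 ≤ A ^ 2 := one_le_pow₀ (by linarith)
        nlinarith
      nlinarith [sq_nonneg C]
    simp only [hcut]
    rw [norm_mul, hM]
    apply mul_le_mul _ hex (norm_nonneg _) (by positivity)
    refine (norm_add_le _ _).trans ?_
    rw [norm_mul, norm_mul, Complex.norm_real, Complex.norm_real, Real.norm_eq_abs,
      Real.norm_eq_abs, Complex.norm_ofNat]
    have : C ≤ C ^ 2 := by nlinarith
    have := mul_le_mul_of_nonneg_right this (sq_nonneg A)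
    nlinarith
  have hcutm : AEStronglyMeasurable cut volume := by
    have hc : cut = -((fun x : ℝ => -(deriv (deriv ⇑u) x) + Complex.I * (x:ℂ) ^ 2 * u x - z * u x)
      - fun x => -(Rm x * u0 x)) := by rw [hfun]; simp
    have hud : Continuous (deriv (deriv ⇑u)) := by
      have h1 := (contDiff_infty_iff_deriv.1 hu0s).2
      exact (contDiff_infty_iff_deriv.1 h1).2.continuous
    have hucont : Continuous u := u.continuous
    have : Continuous fun x : ℝ =>
      -(deriv (deriv ⇑u) x) + Complex.I * (x:ℂ) ^ 2 * u x - z * u x := by fun_prop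
    rw [hc]
    exact (this.aestronglyMeasurable.sub hRu.1).neg
  have hDfin : volume D ≠ ⊤ := ne_top_of_le_ne_top ENNReal.ofReal_ne_top hDv
  have hInd : Integrable (D.indicator fun _ => M ^ 2) volume :=
    (integrable_indicator_iff hDm).2 (integrableOn_const hDfin)
  have hcutle : ∀ x, ‖cut x‖ ^ 2 ≤ D.indicator (fun _ => M ^ 2) x := by
    intro x
    by_cases hx : x ∈ D
    · rw [Set.indicator_of_mem hx]
      exact pow_le_pow_left₀ (norm_nonneg _) (hcutb x hx) 2
    · rw [Set.indicator_of_notMem hx, hcutz x hx]; simp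
  have hcutL : MemLp cut 2 volume := by
    rw [memLp_two_iff_integrable_sq_norm hcutm]
    apply Integrable.mono' hInd (hcutm.norm.pow 2)
    refine Filter.Eventually.of_forall fun x => ?_
    change ‖‖cut x‖ ^ 2‖ ≤ _
    rw [Real.norm_of_nonneg (sq_nonneg _)]
    exact hcutle x
  have hcutN : N2 cut ^ 2 ≤ M ^ 2 * (2 * A) := by
    rw [N2_sq hcutL]
    refine (integral_mono (int_sq hcutL) hInd hcutle).trans ?_
    rw [integral_indicator hDm, setIntegral_const, smul_eq_mul, mul_comm]
    apply mul_le_mul_of_nonneg_left _ (by positivity)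
    exact ENNReal.toReal_le_of_le_ofReal (by positivity) hDv
  -- lower bound of the norm of u
  set J := Set.Icc (-B) (-B + A / s) with hJ
  have hAs : A / s ≤ A := div_le_self hA0.le hs
  have hJb : ∀ x ∈ J, Real.exp (-2) ≤ ‖u0 x‖ ^ 2 := by
    intro x hx
    have hx1 := hx.1
    have hx2 := hx.2
    have hAs' : A / s ≤ 2 * B - A := by linarith
    have h1 : T ((B - x) / A) = 1 := by
      apply hTo; rw [le_div_iff₀ hA0]; linarith
    have h2 : T ((x + 4 * B) / A) = 1 := by
      apply hTo; rw [le_div_iff₀ hA0]; linarith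
    have h3 : ‖u0 x‖ = Real.exp (Φ x).re := by
      simp [hu0, hχ, h1, h2, Complex.norm_exp]
    rw [h3, ← Real.exp_nat_mul]
    apply Real.exp_le_exp.2
    have := hp1 x hx
    push_cast; linarith
  have hUN : Real.exp (-2) * (A / s) ≤ N2 u0 ^ 2 := by
    rw [N2_sq hU]
    have hJi : Integrable (J.indicator fun _ => Real.exp (-2)) volume :=
      (integrable_indicator_iff measurableSet_Icc).2
        (integrableOn_const (by rw [Real.volume_Icc]; exact ENNReal.ofReal_ne_top))
    have := integral_mono hJi (int_sq hU) (fun x => by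
      by_cases hx : x ∈ J
      · rw [Set.indicator_of_mem hx]; exact hJb x hx
      · rw [Set.indicator_of_notMem hx]; positivity)
    refine le_trans (le_of_eq ?_) this
    rw [integral_indicator measurableSet_Icc, setIntegral_const, smul_eq_mul,
      Real.volume_real_Icc_of_le (by linarith [div_pos hA0 hs0])]
    ring
  have hUpos : 0 < N2 u0 := by
    have : 0 < N2 u0 ^ 2 := lt_of_lt_of_le (by positivity) hUN
    exact lt_of_le_of_ne ENNReal.toReal_nonneg fun h => by rw [← h] at this; norm_num at this
  have hune : u ≠ 0 := by
    intro h
    have h1 : u0 = 0 := by rw [← hucoe, h]; rfl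
    rw [h1] at hUpos
    simp [N2] at hUpos
  have hcutU : N2 cut ≤ 4 * s * M * N2 u0 := by
    apply abs_le_of_sq_le_sq' _ (by positivity) |>.2
    refine hcutN.trans ?_
    have he : 1 / 8 ≤ Real.exp (-2) := by
      rw [Real.exp_neg, one_div]
      apply inv_anti₀ (Real.exp_pos _)
      have := Real.exp_one_lt_d9
      have h2 : Real.exp 2 = Real.exp 1 ^ 2 := by rw [← Real.exp_nat_mul]; norm_num
      rw [h2]
      nlinarith [Real.exp_pos 1]
    have h1 : 1 / 8 * (A / s) ≤ N2 u0 ^ 2 :=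
      (mul_le_mul_of_nonneg_right he (by positivity)).trans hUN
    have h2 : A ≤ 8 * s * N2 u0 ^ 2 := by
      have : 1 / 8 * (A / s) = A / (8 * s) := by field_simp
      rw [this, div_le_iff₀ (by positivity)] at h1
      linarith
    have h3 : 2 * A ≤ 16 * s ^ 2 * N2 u0 ^ 2 := by
      nlinarith [mul_nonneg (mul_nonneg hs0.le (sub_nonneg.2 hs)) (sq_nonneg (N2 u0))]
    calc M ^ 2 * (2 * A) ≤ M ^ 2 * (16 * s ^ 2 * N2 u0 ^ 2) :=
          mul_le_mul_of_nonneg_left h3 (by positivity)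
      _ = _ := by ring
  have hRuN : N2 (fun x => -(Rm x * u0 x)) ≤ 3 / a * N2 u0 := by
    apply N2_le (by positivity) hRu hU
    intro x
    rw [norm_neg, norm_mul]
    exact mul_le_mul_of_nonneg_right (hRb x) (norm_nonneg _)
  have hncut : N2 (-cut) ≤ 1 * N2 cut := by
    apply N2_le (by norm_num) hcutL.neg hcutL
    intro x; simp
  have htot : N2 (-cut + fun x => -(Rm x * u0 x)) ≤ (3 / a + 4 * s * M) * N2 u0 := by
    have := N2_add hcutL.neg hRu
    linarith
  have hmem : mQ z ≤ N2 (-cut + fun x => -(Rm x * u0 x)) / N2 u0 := by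
    unfold mQ
    apply csInf_le
    · refine ⟨0, ?_⟩
      rintro r ⟨w, -, rfl⟩
      exact div_nonneg ENNReal.toReal_nonneg ENNReal.toReal_nonneg
    · exact ⟨u, hune, by rw [hfun]; rfl⟩
  refine hmem.trans ?_
  rw [div_le_iff₀ hUpos]
  refine htot.trans (le_of_eq ?_)
  rw [ha, hM, ← pow_mul]
  ring


set_option maxHeartbeats 1000000 in
lemma upper_choice {C ε δ : ℝ} (hC : 0 < C) (hε : 0 < ε) (hδ : 0 < δ) :
    ∃ A0 : ℝ, 2 ≤ A0 ∧ ∀ A s : ℝ, A0 ≤ A → 0 ≤ s → s ≤ A ^ 2 →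
      3 * Real.log A * (1 + δ) ≤ s ^ 3 → 1 ≤ s ∧
      ∃ E, E ≤ (1 - s ^ 4 / (8 * A ^ 8) - s / A ^ 8) * (2 / 3 * s ^ 3 - s / 2) ∧
        E ≤ 10 / 9 * s ^ 3 ∧ 3 / A ^ 6 + C * A ^ 2 * s * Real.exp (-E) < ε := by
  have hlim := (Real.tendsto_pow_mul_exp_neg_atTop_nhds_zero 3).eventually
    (gt_mem_nhds (show (0:ℝ) < ε / (2 * C) by positivity))
  obtain ⟨S0, hS0⟩ := Filter.eventually_atTop.1 hlim
  set κ : ℝ := min (2 / 3 * (δ / (1 + δ))) (1 / 8) with hκ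
  have hκ0 : 0 < κ := lt_min (by positivity) (by norm_num)
  have hκ1 : κ ≤ 2 / 3 * (δ / (1 + δ)) := min_le_left _ _
  have hκ2 : κ ≤ 1 / 8 := min_le_right _ _
  set S : ℝ := max (max S0 1) (5 / (2 * κ)) with hS
  have hSS0 : S0 ≤ S := (le_max_left _ _).trans (le_max_left _ _)
  have hS1 : 1 ≤ S := (le_max_right _ _).trans (le_max_left _ _)
  have hSκ : 5 / (2 * κ) ≤ S := le_max_right _ _
  refine ⟨max (max 2 (7 / ε)) (Real.exp (S ^ 3)), (le_max_left _ _).trans (le_max_left _ _), ?_⟩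
  intro A s hA hs hsA hls
  have hA2 : 2 ≤ A := ((le_max_left _ _).trans (le_max_left _ _)).trans hA
  have hAε : 7 / ε ≤ A := ((le_max_right _ _).trans (le_max_left _ _)).trans hA
  have hAS : Real.exp (S ^ 3) ≤ A := (le_max_right _ _).trans hA
  have hA0 : 0 < A := by linarith
  have hl : S ^ 3 ≤ Real.log A := (Real.le_log_iff_exp_le hA0).2 hAS
  have hS3 : 0 < S ^ 3 := by positivity
  have hsS : S ≤ s := by
    by_contra h
    have : s ^ 3 ≤ S ^ 3 := pow_le_pow_left₀ hs (not_le.1 h).le 3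
    nlinarith [mul_pos (hS3.trans_le hl) hδ]
  have hs1 : 1 ≤ s := hS1.trans hsS
  have hs0 : 0 < s := by linarith
  refine ⟨hs1, ?_⟩
  have hs3 : s ≤ s ^ 3 := le_self_pow₀ hs1 (by norm_num)
  have hlimS : s ^ 3 * Real.exp (-s) < ε / (2 * C) := hS0 s (hSS0.trans hsS)
  have hexp : 1 + s / 2 - κ * s ^ 3 ≤ -s := by
    have h1 : 5 ≤ S * (2 * κ) := by rwa [div_le_iff₀ (by positivity)] at hSκ
    have h2 : 5 / 2 ≤ κ * s := by nlinarith
    have h3 : 5 / 2 ≤ κ * s ^ 2 := by nlinarith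
    have h4 : 5 / 2 * s ≤ κ * s ^ 3 := by nlinarith
    linarith
  have hmain : C * (s ^ 3 * Real.exp (1 + s / 2 - κ * s ^ 3)) < ε / 2 := by
    calc C * (s ^ 3 * Real.exp (1 + s / 2 - κ * s ^ 3))
        ≤ C * (s ^ 3 * Real.exp (-s)) := by gcongr
      _ < C * (ε / (2 * C)) := by gcongr
      _ = ε / 2 := by field_simp
  have h3A : 3 / A ^ 6 < ε / 2 := by
    have h1 : A ≤ A ^ 6 := le_self_pow₀ (by linarith) (by norm_num)
    rw [div_le_iff₀ hε] at hAε
    rw [div_lt_iff₀ (by positivity)]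
    nlinarith
  have hD : 0 ≤ 2 / 3 * s ^ 3 - s / 2 := by linarith
  have hD' : 2 / 3 * s ^ 3 - s / 2 ≤ 2 / 3 * s ^ 3 := by linarith
  rcases le_total s A with hcase | hcase
  · refine ⟨2 / 3 * s ^ 3 - s / 2 - 1, ?_, by nlinarith, ?_⟩
    · have h1 : s ^ 4 / (8 * A ^ 8) * s ^ 3 ≤ 1 / 8 := by
        rw [div_mul_eq_mul_div, div_le_iff₀ (by positivity)]
        have e1 : s ^ 7 ≤ A ^ 7 := pow_le_pow_left₀ hs hcase 7
        have e2 : A ^ 7 ≤ A ^ 8 := pow_le_pow_right₀ (by linarith) (by norm_num)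
        nlinarith
      have h2 : s / A ^ 8 * s ^ 3 ≤ 1 := by
        rw [div_mul_eq_mul_div, div_le_iff₀ (by positivity)]
        have e1 : s ^ 4 ≤ A ^ 4 := pow_le_pow_left₀ hs hcase 4
        have e2 : A ^ 4 ≤ A ^ 8 := pow_le_pow_right₀ (by linarith) (by norm_num)
        nlinarith
      have h3 := mul_le_mul_of_nonneg_left hD' (show 0 ≤ s ^ 4 / (8 * A ^ 8) by positivity)
      have h4 := mul_le_mul_of_nonneg_left hD' (show 0 ≤ s / A ^ 8 by positivity)
      generalize s ^ 4 / (8 * A ^ 8) = p at *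
      generalize s / A ^ 8 = q at *
      have e1 : (1 - p - q) * (2 / 3 * s ^ 3 - s / 2) = (2 / 3 * s ^ 3 - s / 2)
        - p * (2 / 3 * s ^ 3 - s / 2) - q * (2 / 3 * s ^ 3 - s / 2) := by ring
      have e2 : p * (2 / 3 * s ^ 3) = 2 / 3 * (p * s ^ 3) := by ring
      have e3 : q * (2 / 3 * s ^ 3) = 2 / 3 * (q * s ^ 3) := by ring
      rw [e1]
      linarith
    · have hA2e : A ^ 2 ≤ Real.exp (2 / 3 * s ^ 3 / (1 + δ)) := by
        have : A ^ 2 = Real.exp (2 * Real.log A) := by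
          rw [mul_comm, Real.exp_mul, Real.exp_log hA0]; norm_num
        rw [this]
        apply Real.exp_le_exp.2
        rw [le_div_iff₀ (by linarith)]
        linarith
      have h1 : A ^ 2 * s * Real.exp (-(2 / 3 * s ^ 3 - s / 2 - 1))
          ≤ s ^ 3 * Real.exp (1 + s / 2 - κ * s ^ 3) := by
        calc A ^ 2 * s * Real.exp (-(2 / 3 * s ^ 3 - s / 2 - 1))
            ≤ Real.exp (2 / 3 * s ^ 3 / (1 + δ)) * s ^ 3
              * Real.exp (-(2 / 3 * s ^ 3 - s / 2 - 1)) := by gcongr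
          _ = s ^ 3 * Real.exp (2 / 3 * s ^ 3 / (1 + δ) + -(2 / 3 * s ^ 3 - s / 2 - 1)) := by
            rw [Real.exp_add]; ring
          _ ≤ _ := by
            apply mul_le_mul_of_nonneg_left _ (by positivity)
            apply Real.exp_le_exp.2
            have e1 := mul_le_mul_of_nonneg_right hκ1 (show 0 ≤ s ^ 3 by positivity)
            have e2 : 2 / 3 * s ^ 3 / (1 + δ) = 2 / 3 * s ^ 3 - 2 / 3 * (δ / (1 + δ)) * s ^ 3 := by
              field_simp; ring
            linarith
      have h2 := mul_le_mul_of_nonneg_left h1 hC.le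
      rw [← mul_assoc, ← mul_assoc] at h2
      linarith
  · refine ⟨s ^ 3 / 8, ?_, by nlinarith [pow_pos hs0 3], ?_⟩
    · have h1 : s ^ 4 / (8 * A ^ 8) ≤ 1 / 8 := by
        rw [div_le_iff₀ (by positivity)]
        have e1 : s ^ 4 ≤ (A ^ 2) ^ 4 := pow_le_pow_left₀ hs hsA 4
        have e2 : (A ^ 2) ^ 4 = A ^ 8 := by ring
        linarith
      have h2 : s / A ^ 8 ≤ 1 / 8 := by
        rw [div_le_iff₀ (by positivity)]
        have e1 : (2:ℝ) ^ 6 ≤ A ^ 6 := pow_le_pow_left₀ (by norm_num) hA2 6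
        have e2 : A ^ 8 = A ^ 6 * A ^ 2 := by ring
        have e3 := mul_le_mul_of_nonneg_right e1 (sq_nonneg A)
        nlinarith
      have h3 : s ^ 3 / 6 ≤ 2 / 3 * s ^ 3 - s / 2 := by linarith
      have h4 := mul_le_mul (show (3:ℝ) / 4 ≤ 1 - s ^ 4 / (8 * A ^ 8) - s / A ^ 8 by linarith)
        h3 (by positivity) (by linarith)
      linarith
    · have h1 : A ^ 2 * s * Real.exp (-(s ^ 3 / 8))
          ≤ s ^ 3 * Real.exp (1 + s / 2 - κ * s ^ 3) := by
        have e1 : A ^ 2 * s ≤ s ^ 3 := by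
          have := pow_le_pow_left₀ hA0.le hcase 2
          nlinarith
        apply mul_le_mul e1 _ (Real.exp_pos _).le (by positivity)
        apply Real.exp_le_exp.2
        have e2 := mul_le_mul_of_nonneg_right hκ2 (show 0 ≤ s ^ 3 by positivity)
        linarith
      have h2 := mul_le_mul_of_nonneg_left h1 hC.le
      rw [← mul_assoc, ← mul_assoc] at h2
      linarith

lemma lower_choice {η : ℝ} (hη : 0 < η) :
    ∃ L0 : ℝ, 0 < L0 ∧ ∀ A s : ℝ, 0 < A → L0 ≤ Real.log A → 0 ≤ s →
      s ^ 3 ≤ 3 * Real.log A * (1 - η) →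
      4 * Real.exp (2 * (s ^ 3 / 3 + Real.pi * √(s ^ 2 + 3))) ≤ A ^ 2 := by
  set s1 := √(24 / η) with hs1
  have hs1p : 0 < s1 := Real.sqrt_pos.2 (by positivity)
  have hs1s : s1 ^ 2 = 24 / η := Real.sq_sqrt (by positivity)
  refine ⟨(18 + 8 * s1) / η, by positivity, ?_⟩
  intro A s hA hL hs hs3
  set ℓ := Real.log A with hℓ
  have hℓ0 : 0 < ℓ := lt_of_lt_of_le (by positivity) hL
  rw [div_le_iff₀ hη] at hL
  have h1 : √(s ^ 2 + 3) ≤ s + 2 := by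
    rw [Real.sqrt_le_left (by linarith)]; nlinarith
  have h2 : 8 * s ≤ 8 * s1 + ℓ * η := by
    rcases le_total s s1 with h | h
    · nlinarith
    · have e1 : s * s1 ^ 2 ≤ s ^ 3 := by
        have := pow_le_pow_left₀ hs1p.le h 2
        nlinarith
      have e2 : s * s1 ^ 2 ≤ 3 * ℓ := by nlinarith
      rw [hs1s, mul_div_assoc', div_le_iff₀ hη] at e2
      nlinarith
  have h3 : Real.pi * √(s ^ 2 + 3) ≤ 4 * (s + 2) :=
    mul_le_mul Real.pi_le_four h1 (Real.sqrt_nonneg _) (by norm_num)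
  have h4 : (4:ℝ) ≤ Real.exp 2 := by
    have := Real.exp_one_gt_d9
    have h2 : Real.exp 2 = Real.exp 1 ^ 2 := by rw [← Real.exp_nat_mul]; norm_num
    rw [h2]; nlinarith
  have h5 : A ^ 2 = Real.exp (2 * ℓ) := by
    rw [mul_comm, Real.exp_mul, Real.exp_log hA]; norm_num
  calc 4 * Real.exp (2 * (s ^ 3 / 3 + Real.pi * √(s ^ 2 + 3)))
      ≤ Real.exp 2 * Real.exp (2 * (s ^ 3 / 3 + Real.pi * √(s ^ 2 + 3))) := by gcongr
    _ = Real.exp (2 + 2 * (s ^ 3 / 3 + Real.pi * √(s ^ 2 + 3))) := by rw [Real.exp_add]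
    _ ≤ Real.exp (2 * ℓ) := by
      apply Real.exp_le_exp.2
      linarith
    _ = A ^ 2 := h5.symm

lemma rpow_two_thirds_cube {x : ℝ} (hx : 0 ≤ x) : (x ^ ((2:ℝ) / 3)) ^ 3 = x ^ 2 := by
  rw [← Real.rpow_natCast, ← Real.rpow_mul hx, ← Real.rpow_natCast]
  norm_num

lemma le_of_cube_le {x y : ℝ} (hy : 0 ≤ y) (h : x ^ 3 ≤ y ^ 3) : x ≤ y :=
  le_of_not_gt fun hlt => absurd h (not_le.2 (pow_lt_pow_left₀ hlt hy (by norm_num)))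

set_option maxHeartbeats 2000000 in
lemma level_line_main :
    ∃ ε₀ : ℝ, 0 < ε₀ ∧ ∀ ε ∈ Set.Ioo (0:ℝ) ε₀, ∀ δ : ℝ, 0 < δ →
      ∃ R : ℝ, 0 < R ∧ ∀ z : ℂ, R ≤ z.re → 0 ≤ z.im → z.im ≤ z.re → mQ z = ε →
        |z.im - ((3:ℝ)/2) ^ ((2:ℝ)/3) * z.re ^ ((1:ℝ)/3)
            * (Real.log (z.re ^ ((1:ℝ)/3) / ε)) ^ ((2:ℝ)/3)|
          ≤ δ * z.re ^ ((1:ℝ)/3) * (Real.log z.re) ^ ((2:ℝ)/3) := by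
  refine ⟨1, one_pos, ?_⟩
  intro ε hε δ hδ
  obtain ⟨hε0, hε1⟩ := hε
  obtain ⟨C, hC, hup⟩ := mQ_upper
  obtain ⟨A0, hA02, hA0⟩ := upper_choice hC hε0 hδ
  obtain ⟨L0, hL0, hlow⟩ := lower_choice (half_pos hδ)
  set K := max (max A0 (Real.exp L0)) (Real.exp (Real.log (1 / ε) / δ)) with hK
  have hK2 : 2 ≤ K := hA02.trans ((le_max_left _ _).trans (le_max_left _ _))
  refine ⟨K ^ 6, by positivity, ?_⟩
  intro z hR him0 hzz hm
  have hne : ∃ u : SchwartzMap ℝ ℂ, u ≠ 0 := by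
    by_contra! h
    have : mQ z = 0 := by
      unfold mQ
      convert Real.sInf_empty
      rw [Set.eq_empty_iff_forall_notMem]
      rintro r ⟨u, hu, -⟩
      exact hu (h u)
    linarith
  have ha0 : 0 < z.re := lt_of_lt_of_le (by positivity) hR
  set A := z.re ^ ((1:ℝ) / 6) with hAdef
  have hAp : 0 < A := Real.rpow_pos_of_pos ha0 _
  have hA6 : A ^ 6 = z.re := by
    rw [hAdef, ← Real.rpow_natCast, ← Real.rpow_mul ha0.le]; norm_num
  have hA2 : z.re ^ ((1:ℝ) / 3) = A ^ 2 := by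
    rw [hAdef, ← Real.rpow_natCast, ← Real.rpow_mul ha0.le]; norm_num
  have hKA : K ≤ A := by
    rw [← hA6] at hR
    exact le_of_not_gt fun h => absurd hR (not_le.2 (pow_lt_pow_left₀ h hAp.le (by norm_num)))
  have hAA0 : A0 ≤ A := ((le_max_left _ _).trans (le_max_left _ _)).trans hKA
  have hAL0 : L0 ≤ Real.log A := (Real.le_log_iff_exp_le hAp).2
    (((le_max_right _ _).trans (le_max_left _ _)).trans hKA)
  have hAε : Real.log (1 / ε) / δ ≤ Real.log A := (Real.le_log_iff_exp_le hAp).2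
    ((le_max_right _ _).trans hKA)
  set ℓ := Real.log A with hℓ
  have hℓ0 : 0 < ℓ := hL0.trans_le hAL0
  have hloga : Real.log z.re = 6 * ℓ := by
    rw [← hA6, Real.log_pow, ← hℓ]; norm_num
  have hε' : 0 < Real.log (1 / ε) := Real.log_pos (by rw [lt_div_iff₀ hε0]; linarith)
  have hlog : Real.log (A ^ 2 / ε) = 2 * ℓ + Real.log (1 / ε) := by
    rw [div_eq_mul_one_div, Real.log_mul (by positivity) (by positivity), Real.log_pow, ← hℓ]
    norm_num
  rw [div_le_iff₀ hδ] at hAε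
  rw [hA2, hloga, hlog]
  set L := 2 * ℓ + Real.log (1 / ε) with hL
  have hLp : 0 < L := by linarith
  set s := √z.im / A with hs
  have hs0 : 0 ≤ s := by positivity
  have hAs : z.im = (A * s) ^ 2 := by
    rw [hs, mul_div_cancel₀ _ hAp.ne', Real.sq_sqrt him0]
  have hsA : s ≤ A ^ 2 := by
    have h1 : (A * s) ^ 2 ≤ (A ^ 3) ^ 2 := by
      rw [← hAs, ← pow_mul]; norm_num; linarith
    have h2 := abs_le_of_sq_le_sq' h1 (by positivity) |>.2
    have h3 : A * s ≤ A * A ^ 2 := by linarith [show A ^ 3 = A * A ^ 2 by ring]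
    exact le_of_mul_le_mul_left h3 hAp
  have hre : z.re = (A ^ 3) ^ 2 := by rw [← hA6]; ring
  set X := (3 * ℓ) ^ ((2:ℝ) / 3) with hX
  have hXp : 0 < X := Real.rpow_pos_of_pos (by linarith) _
  have hX3 : X ^ 3 = (3 * ℓ) ^ 2 := rpow_two_thirds_cube (by linarith)
  set Y := (3 / 2 * L) ^ ((2:ℝ) / 3) with hY
  have hY3 : Y ^ 3 = (3 / 2 * L) ^ 2 := rpow_two_thirds_cube (by linarith)
  have hYe : ((3:ℝ) / 2) ^ ((2:ℝ) / 3) * L ^ ((2:ℝ) / 3) = Y :=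
    (Real.mul_rpow (by norm_num) hLp.le).symm
  set W := (6 * ℓ) ^ ((2:ℝ) / 3) with hW
  have hXW : X ≤ W := Real.rpow_le_rpow (by linarith) (by linarith) (by norm_num)
  have hXY : X ≤ Y := Real.rpow_le_rpow (by linarith) (by linarith) (by norm_num)
  have hYX : Y ≤ X * (1 + δ / 2) := by
    apply le_of_cube_le (by positivity)
    rw [hY3, mul_pow X, hX3]
    have h1 : 3 / 2 * L ≤ 3 * ℓ * (1 + δ / 2) := by nlinarith
    have h2 := pow_le_pow_left₀ (by linarith) h1 2
    have h3 : (1 + δ / 2) ^ 2 ≤ (1 + δ / 2) ^ 3 := by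
      apply pow_le_pow_right₀ (by linarith) (by norm_num)
    have h4 := mul_le_mul_of_nonneg_left h3 (sq_nonneg (3 * ℓ))
    rw [mul_pow (3 * ℓ)] at h2
    linarith
  have hA2p : 0 < A ^ 2 := by positivity
  have hrew : z.im - (3 / 2) ^ ((2:ℝ) / 3) * A ^ 2 * L ^ ((2:ℝ) / 3) = A ^ 2 * (s ^ 2 - Y) := by
    rw [← hYe, hAs]; ring
  rw [hrew, abs_mul, abs_of_pos hA2p, mul_comm δ, mul_assoc]
  apply mul_le_mul_of_nonneg_left _ hA2p.le
  have hδXW : δ * X ≤ δ * W := mul_le_mul_of_nonneg_left hXW hδ.le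
  rw [abs_le]
  constructor
  · by_contra hcon
    have h1 : s ^ 2 ≤ X * (1 - δ / 2) := by
      rw [not_le] at hcon
      linarith
    have hδ2 : 0 ≤ 1 - δ / 2 := by
      by_contra h
      nlinarith [sq_nonneg s, mul_pos hXp (neg_pos.2 (not_le.1 h))]
    have h2 : s ^ 3 ≤ 3 * ℓ * (1 - δ / 2) := by
      apply abs_le_of_sq_le_sq' _ (by positivity) |>.2
      have h3 := pow_le_pow_left₀ (sq_nonneg s) h1 3
      rw [mul_pow X, hX3] at h3
      have h4 : (1 - δ / 2) ^ 3 ≤ (1 - δ / 2) ^ 2 :=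
        pow_le_pow_of_le_one hδ2 (by linarith) (by norm_num)
      have h5 := mul_le_mul_of_nonneg_left h4 (sq_nonneg (3 * ℓ))
      rw [mul_pow (3 * ℓ)]
      linarith [show (s ^ 3) ^ 2 = (s ^ 2) ^ 3 by ring]
    have := mQ_lower (hK2.trans hKA) hs0 hsA (hlow A s hAp hAL0 hs0 h2) hre hAs hne
    linarith
  · by_contra hcon
    have h1 : X * (1 + δ) ≤ s ^ 2 := by
      rw [not_le] at hcon
      linarith
    have h2 : 3 * ℓ * (1 + δ) ≤ s ^ 3 := by
      apply abs_le_of_sq_le_sq' _ (by positivity) |>.2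
      have h3 := pow_le_pow_left₀ (by positivity) h1 3
      rw [mul_pow X, hX3] at h3
      have h4 : (1 + δ) ^ 2 ≤ (1 + δ) ^ 3 :=
        pow_le_pow_right₀ (by linarith) (by norm_num)
      have h5 := mul_le_mul_of_nonneg_left h4 (sq_nonneg (3 * ℓ))
      rw [mul_pow (3 * ℓ)]
      linarith [show (s ^ 3) ^ 2 = (s ^ 2) ^ 3 by ring]
    obtain ⟨hs1, E, hE1, hE2, hE3⟩ := hA0 A s hAA0 hs0 hsA h2
    have := hup A s E (hK2.trans hKA) hs1 hsA hE1 hE2 z hre hAs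
    linarith

/-- Asymptotics of the level lines of the resolvent norm of the non-self-adjoint harmonic
oscillator `Q = Dₓ² + ix²` below the diagonal `e^{iπ/4}ℝ`: on the level line
`‖(Q − z)^{-1}‖ = 1/ε`,
`Im z = (3/2)^{2/3}(Re z)^{1/3}(ln((Re z)^{1/3}/ε))^{2/3}(1 + o(1))` as `Re z → ∞`. -/
theorem stmt_12 :
    ∃ ε₀ : ℝ, 0 < ε₀ ∧ ∀ ε ∈ Set.Ioo (0:ℝ) ε₀, ∀ δ : ℝ, 0 < δ →
      ∃ R : ℝ, 0 < R ∧ ∀ z : ℂ, R ≤ z.re → 0 ≤ z.im → z.im ≤ z.re → mQ z = ε →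
        |z.im - ((3:ℝ)/2) ^ ((2:ℝ)/3) * z.re ^ ((1:ℝ)/3)
            * (Real.log (z.re ^ ((1:ℝ)/3) / ε)) ^ ((2:ℝ)/3)|
          ≤ δ * z.re ^ ((1:ℝ)/3) * (Real.log z.re) ^ ((2:ℝ)/3) := by
  exact level_line_main
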